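/- arXiv:2003.04373 — 2 statements merged into one kernel-verified Lean document; each statement's English description precedes it below -/
import Mathlib

section
/- Let G be a finite group and k a field of characteristic p > 0 dividing the order of G. Then for every finite-dimensional kG-module M there exists a finite-dimensional kG-module N such that M ⊕ N admits a finite permutation resolution, i.e. there is an exact sequence of kG-modules 0 → P_n → P_{n-1} → ⋯ → P_1 → P_0 → M ⊕ N → 0 in which every P_i is a permutation module. -/
open CategoryTheory

def IsPermutationModule (k G : Type) [Field k] [Group G]
    (P : Type) [AddCommGroup P] [Module (MonoidAlgebra k G) P] : Prop :=
  ∃ (X : Type) (_ : Fintype X) (m : MulAction G X),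
    Nonempty (P ≃ₗ[MonoidAlgebra k G] (@Representation.ofMulAction k _ G _ X m).asModule)

def HasPermResFreeUpTo (k G : Type) [Field k] [Group G] (m : ℕ)
    (M : Type) [AddCommGroup M] [Module (MonoidAlgebra k G) M] : Prop :=
  ∃ (n : ℕ) (P : ℕ → ModuleCat (MonoidAlgebra k G))
    (d : ∀ i, P (i + 1) ⟶ P i) (ε : P 0 ⟶ ModuleCat.of (MonoidAlgebra k G) M),
    (∀ i, IsPermutationModule k G (P i)) ∧
    (∀ i ≤ m, Module.Free (MonoidAlgebra k G) (P i)) ∧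
    (∀ i, n < i → Subsingleton (P i)) ∧
    Function.Surjective ε ∧
    Function.Exact (d 0) ε ∧
    ∀ i, Function.Exact (d (i + 1)) (d i)

def HasFinitePermRes (k G : Type) [Field k] [Group G]
    (M : Type) [AddCommGroup M] [Module (MonoidAlgebra k G) M] : Prop :=
  ∃ (n : ℕ) (P : ℕ → ModuleCat (MonoidAlgebra k G))
    (d : ∀ i, P (i + 1) ⟶ P i) (ε : P 0 ⟶ ModuleCat.of (MonoidAlgebra k G) M),
    (∀ i, IsPermutationModule k G (P i)) ∧
    (∀ i, n < i → Subsingleton (P i)) ∧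
    Function.Surjective ε ∧
    Function.Exact (d 0) ε ∧
    ∀ i, Function.Exact (d (i + 1)) (d i)

def HasGoodPermRes (k G : Type) [Field k] [Group G]
    (M : Type) [AddCommGroup M] [Module (MonoidAlgebra k G) M] : Prop :=
  ∀ m : ℕ, HasPermResFreeUpTo k G m M

namespace PermRes

open MonoidAlgebra

variable {k G : Type} [Field k] [Group G]

/-- The permutation representation of `G` on the `k`-valued functions on a `G`-set. -/
@[simps]
def funRep (k G X : Type) [Field k] [Group G] [MulAction G X] : Representation k G (X → k) where
  toFun g := LinearMap.funLeft k k (g⁻¹ • ·)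
  map_one' := by ext; simp
  map_mul' g h := by ext; simp [mul_smul]

theorem isPermutationModule_of_addEquiv {P : Type} [AddCommGroup P] [Module (MonoidAlgebra k G) P]
    {X : Type} [Finite X] [MulAction G X] (e : P ≃+ (X → k))
    (he : ∀ (g : G) (c : k) (v : P) (x : X), e (single g c • v) x = c * e v (g⁻¹ • x)) :
    IsPermutationModule k G P := by
  classical
  have := Fintype.ofFinite X
  let f : P ≃+ (Representation.ofMulAction k G X).asModule :=
    e.trans (((MonoidAlgebra.coeffLinearEquiv k).trans
      (Finsupp.linearEquivFunOnFinite k k X)).symm.toAddEquiv.trans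
      (Representation.ofMulAction k G X).asModuleEquiv.symm.toAddEquiv)
  have key : ∀ (v : P) (x : X), (Representation.asModuleEquiv _ (f v)).coeff x = e v x := by
    intro v x
    rfl
  have hf : ∀ (g : G) (c : k) (v : P), f (single g c • v) = single g c • f v := by
    intro g c v
    apply (Representation.asModuleEquiv _).injective
    apply (MonoidAlgebra.coeffLinearEquiv k).injective
    ext x
    change (Representation.asModuleEquiv _ (f _)).coeff x = _
    rw [key, he, Representation.single_smul]
    change _ = (c • (Representation.ofMulAction k G X) g _).coeff x
    rw [MonoidAlgebra.coeff_smul]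
    change _ = c * (((Representation.ofMulAction k G X) g _).coeff x)
    rw [Representation.coeff_ofMulAction, key]
  refine ⟨X, inferInstance, inferInstance, ⟨{ f with map_smul' := ?_ }⟩⟩
  intro a v
  change f (a • v) = a • f v
  induction a using MonoidAlgebra.induction_linear with
  | zero => simp
  | add x y hx hy => simp [add_smul, hx, hy]
  | single g c => exact hf g c v

theorem exists_addEquiv_of_isPermutationModule {P : Type} [AddCommGroup P]
    [Module (MonoidAlgebra k G) P] (h : IsPermutationModule k G P) :
    ∃ (X : Type) (_ : Fintype X) (_ : MulAction G X) (e : P ≃+ (X → k)),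
      ∀ (g : G) (c : k) (v : P) (x : X), e (single g c • v) x = c * e v (g⁻¹ • x) := by
  obtain ⟨X, hX, m, ⟨f⟩⟩ := h
  refine ⟨X, hX, m, f.toAddEquiv.trans
    ((Representation.ofMulAction k G X).asModuleEquiv.toAddEquiv.trans
      ((MonoidAlgebra.coeffLinearEquiv k).trans
      (Finsupp.linearEquivFunOnFinite k k X)).toAddEquiv), ?_⟩
  intro g c v x
  change (Representation.asModuleEquiv _ (f (single g c • v))).coeff x =
    c * (Representation.asModuleEquiv _ (f v)).coeff (g⁻¹ • x)
  rw [map_smul, Representation.single_smul]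
  change (c • (Representation.ofMulAction k G X) g _).coeff x = _
  rw [MonoidAlgebra.coeff_smul]
  change c * (((Representation.ofMulAction k G X) g _).coeff x) = _
  rw [Representation.coeff_ofMulAction]

theorem isPermutationModule_of_subsingleton (P : Type) [AddCommGroup P]
    [Module (MonoidAlgebra k G) P] [Subsingleton P] : IsPermutationModule k G P := by
  let _ : MulAction G Empty :=
    { smul := fun _ x => x, one_smul := fun x => x.elim, mul_smul := fun _ _ x => x.elim }
  exact isPermutationModule_of_addEquiv (X := Empty)
    { toFun := fun _ => 0, invFun := fun _ => 0, left_inv := fun _ => Subsingleton.elim _ _,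
      right_inv := fun _ => Subsingleton.elim _ _, map_add' := fun _ _ => by simp }
    (fun _ _ _ x => x.elim)

theorem isPermutationModule_prod {P Q : Type} [AddCommGroup P] [Module (MonoidAlgebra k G) P]
    [AddCommGroup Q] [Module (MonoidAlgebra k G) Q]
    (hP : IsPermutationModule k G P) (hQ : IsPermutationModule k G Q) :
    IsPermutationModule k G (P × Q) := by
  obtain ⟨X, hX, mX, e, he⟩ := exists_addEquiv_of_isPermutationModule hP
  obtain ⟨Y, hY, mY, f, hf⟩ := exists_addEquiv_of_isPermutationModule hQ
  let _ : MulAction G (X ⊕ Y) :=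
    { smul := fun g => Sum.map (g • ·) (g • ·)
      one_smul := by rintro (x | x) <;> simp [HSMul.hSMul] <;> exact one_smul G x
      mul_smul := by
        rintro g h (x | x)
        · exact congrArg Sum.inl (mul_smul g h x)
        · exact congrArg Sum.inr (mul_smul g h x) }
  refine isPermutationModule_of_addEquiv (X := X ⊕ Y)
    ((e.prodCongr f).trans
      { (Equiv.sumArrowEquivProdArrow X Y k).symm with
        map_add' := ?_ }) ?_
  · intro a b
    ext (x | x) <;> rfl
  · rintro g c ⟨v, w⟩ (x | x)
    · exact he g c v x
    · exact hf g c w x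

/-- An additive map commuting with the action of the elements `c • g` of the group algebra is
linear over the group algebra. -/
@[simps]
def linearMapOfSingle {V W : Type} [AddCommGroup V] [Module (MonoidAlgebra k G) V]
    [AddCommGroup W] [Module (MonoidAlgebra k G) W] (f : V →+ W)
    (hf : ∀ (g : G) (c : k) (v : V), f (single g c • v) = single g c • f v) :
    V →ₗ[MonoidAlgebra k G] W where
  toFun := f
  map_add' := f.map_add
  map_smul' a v := by
    induction a using MonoidAlgebra.induction_linear with
    | zero => simp
    | add x y hx hy => simp_all [add_smul]
    | single g c => exact hf g c v

/-- `M` has a resolution by permutation modules of length less than `n`, whose first `r` terms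
are projective. -/
def Res (k G : Type) [Field k] [Group G] :
    ℕ → ℕ → ∀ (M : Type) [AddCommGroup M] [Module (MonoidAlgebra k G) M], Prop
  | _, 0, M, _, _ => Subsingleton M
  | r, n + 1, M, _, _ => ∃ (P : Type) (_ : AddCommGroup P) (_ : Module (MonoidAlgebra k G) P)
      (π : P →ₗ[MonoidAlgebra k G] M), IsPermutationModule k G P ∧
      (0 < r → Module.Projective (MonoidAlgebra k G) P) ∧ Function.Surjective π ∧
      Res k G (r - 1) n (LinearMap.ker π)

namespace Res

variable {M N : Type} [AddCommGroup M] [Module (MonoidAlgebra k G) M]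
  [AddCommGroup N] [Module (MonoidAlgebra k G) N]

theorem congr (e : M ≃ₗ[MonoidAlgebra k G] N) {r n : ℕ} (h : Res k G r n M) :
    Res k G r n N := by
  cases n with
  | zero => exact haveI : Subsingleton M := h; e.symm.injective.subsingleton
  | succ n =>
    obtain ⟨P, _, _, π, h1, h2, h3, h4⟩ := h
    refine ⟨P, _, _, e.toLinearMap ∘ₗ π, h1, h2, e.surjective.comp h3, ?_⟩
    rwa [LinearEquiv.ker_comp]

theorem mono_left {r r' n : ℕ} (hr : r' ≤ r) (h : Res k G r n M) : Res k G r' n M := by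
  induction n generalizing r r' M with
  | zero => exact h
  | succ n ih =>
    obtain ⟨P, _, _, π, h1, h2, h3, h4⟩ := h
    exact ⟨P, _, _, π, h1, fun h => h2 (h.trans_le hr), h3, ih (Nat.sub_le_sub_right hr 1) h4⟩

theorem succ {r n : ℕ} (h : Res k G r n M) : Res k G r (n + 1) M := by
  induction n generalizing r M with
  | zero =>
    have : Subsingleton M := h
    exact ⟨PUnit, inferInstance, inferInstance, 0, isPermutationModule_of_subsingleton _,
      fun _ => inferInstance, fun _ => ⟨0, Subsingleton.elim _ _⟩,
      inferInstanceAs (Subsingleton (LinearMap.ker _))⟩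
  | succ n ih =>
    obtain ⟨P, _, _, π, h1, h2, h3, h4⟩ := h
    exact ⟨P, _, _, π, h1, h2, h3, ih h4⟩

theorem mono_right {r n n' : ℕ} (hn : n ≤ n') (h : Res k G r n M) : Res k G r n' M := by
  induction hn with
  | refl => exact h
  | step _ ih => exact ih.succ

/-- The horseshoe lemma. -/
theorem extension {A B C : Type} [AddCommGroup A] [Module (MonoidAlgebra k G) A]
    [AddCommGroup B] [Module (MonoidAlgebra k G) B] [AddCommGroup C] [Module (MonoidAlgebra k G) C]
    (i : A →ₗ[MonoidAlgebra k G] B) (q : B →ₗ[MonoidAlgebra k G] C)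
    (hi : Function.Injective i) (hiq : Function.Exact i q) (hq : Function.Surjective q)
    {r r' a c n : ℕ} (hr : r ≤ r') (har : a ≤ r') (han : a ≤ n) (hcn : c ≤ n)
    (hA : Res k G r a A) (hC : Res k G r' c C) : Res k G r n B := by
  induction n generalizing r r' a c A B C with
  | zero =>
    obtain rfl : a = 0 := by lia
    obtain rfl : c = 0 := by lia
    have : Subsingleton A := hA
    have : Subsingleton C := hC
    refine subsingleton_of_forall_eq (0 : B) fun b => ?_
    obtain ⟨x, rfl⟩ := (hiq b).1 (Subsingleton.elim _ _)
    rw [Subsingleton.elim x 0, map_zero]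
  | succ n ih =>
    cases c with
    | zero =>
      have : Subsingleton C := hC
      have hs : Function.Surjective i := fun b => (hiq b).1 (Subsingleton.elim _ _)
      exact (hA.congr (LinearEquiv.ofBijective i ⟨hi, hs⟩)).mono_right han
    | succ c =>
    cases a with
    | zero =>
      have : Subsingleton A := hA
      have hs : Function.Injective q := by
        rw [injective_iff_map_eq_zero]
        intro b hb
        obtain ⟨x, rfl⟩ := (hiq b).1 hb
        rw [Subsingleton.elim x 0, map_zero]
      exact ((hC.mono_left hr).congr
        (LinearEquiv.ofBijective q ⟨hs, hq⟩).symm).mono_right hcn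
    | succ a =>
      obtain ⟨P, _, _, π, hP, hP', hπ, hK⟩ := hA
      obtain ⟨Q, _, _, ρ, hQ, hQ', hρ, hL⟩ := hC
      have := hQ' (by lia)
      obtain ⟨σ, hσ⟩ := Module.projective_lifting_property q ρ hq
      have hσ' (y : Q) : q (σ y) = ρ y := LinearMap.congr_fun hσ y
      have hqi (x : A) : q (i x) = 0 := (hiq _).2 ⟨x, rfl⟩
      let τ : P × Q →ₗ[MonoidAlgebra k G] B := (i ∘ₗ π).coprod σ
      refine ⟨P × Q, _, _, τ, isPermutationModule_prod hP hQ, ?_, ?_, ?_⟩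
      · intro h
        have := hP' h
        infer_instance
      · intro b
        obtain ⟨y, hy⟩ := hρ (q b)
        obtain ⟨x, hx⟩ := (hiq (b - σ y)).1 (by rw [map_sub, hσ', hy, sub_self])
        obtain ⟨z, rfl⟩ := hπ x
        exact ⟨(z, y), by simp [τ, hx]⟩
      · refine ih (r := r - 1) (r' := r' - 1) (a := a) (c := c)
          ((LinearMap.inl _ P Q).restrict (p := LinearMap.ker π) (q := LinearMap.ker τ) ?_)
          ((LinearMap.snd _ P Q).restrict (p := LinearMap.ker τ) (q := LinearMap.ker ρ) ?_)
          ?_ ?_ ?_ (by lia) (by lia) (by lia) (by lia) hK hL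
        · intro x hx
          have hx : π x = 0 := hx
          simp [τ, hx]
        · rintro ⟨x, y⟩ hxy
          have h : i (π x) + σ y = 0 := by simpa [τ] using hxy
          have := congrArg q h
          simpa [hqi, hσ'] using this
        · rintro ⟨x, hx⟩ ⟨y, hy⟩ h
          exact Subtype.ext (congrArg (fun w => w.1.1) h)
        · rintro ⟨⟨x, y⟩, hxy⟩
          have h : i (π x) + σ y = 0 := by simpa [τ] using hxy
          constructor
          · intro h0
            have h0 : y = 0 := congrArg Subtype.val h0
            subst h0
            refine ⟨⟨x, hi (by simpa using h)⟩, ?_⟩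
            rfl
          · rintro ⟨z, hz⟩
            exact Subtype.ext (congrArg (fun w => w.1.2) hz).symm
        · rintro ⟨y, hy⟩
          obtain ⟨x, hx⟩ := (hiq (σ y)).1 (by rw [hσ']; exact hy)
          obtain ⟨z, rfl⟩ := hπ x
          exact ⟨⟨(-z, y), by simp [τ, hx]⟩, rfl⟩

theorem hasFinitePermRes {r n : ℕ} (h : Res k G r n M) : HasFinitePermRes k G M := by
  suffices H : ∃ (P : ℕ → ModuleCat (MonoidAlgebra k G))
      (d : ∀ i, P (i + 1) ⟶ P i) (ε : P 0 ⟶ ModuleCat.of (MonoidAlgebra k G) M),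
      (∀ i, IsPermutationModule k G (P i)) ∧ (∀ i, n ≤ i → Subsingleton (P i)) ∧
      Function.Surjective ε ∧ Function.Exact (d 0) ε ∧ ∀ i, Function.Exact (d (i + 1)) (d i) by
    obtain ⟨P, d, ε, h1, h2, h3⟩ := H
    exact ⟨n, P, d, ε, h1, fun i hi => h2 i hi.le, h3⟩
  induction n generalizing r M with
  | zero =>
    have : Subsingleton M := h
    refine ⟨fun _ => ModuleCat.of _ PUnit, fun _ => 0, 0,
      fun _ => isPermutationModule_of_subsingleton PUnit,
      fun _ _ => inferInstanceAs (Subsingleton PUnit), ?_, ?_, ?_⟩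
    · intro x
      exact ⟨0, Subsingleton.elim (α := M) _ _⟩
    · intro x
      exact ⟨fun _ => ⟨0, Subsingleton.elim (α := PUnit) _ _⟩,
        fun _ => Subsingleton.elim (α := M) _ _⟩
    · intro i x
      exact ⟨fun _ => ⟨0, Subsingleton.elim (α := PUnit) _ _⟩,
        fun _ => Subsingleton.elim (α := PUnit) _ _⟩
  | succ n ih =>
    obtain ⟨Q, _, _, π, hQ, -, hπ, hK⟩ := h
    obtain ⟨P, d, ε, h1, h2, h3, h4, h5⟩ := ih hK
    let P' : ℕ → ModuleCat (MonoidAlgebra k G)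
      | 0 => ModuleCat.of _ Q
      | i + 1 => P i
    let d' : ∀ i, P' (i + 1) ⟶ P' i
      | 0 => ε ≫ ModuleCat.ofHom (LinearMap.ker π).subtype
      | i + 1 => d i
    refine ⟨P', d', ModuleCat.ofHom π, ?_, ?_, hπ, ?_, ?_⟩
    · rintro (_ | i)
      exacts [hQ, h1 i]
    · rintro (_ | i) hi
      exacts [by lia, h2 i (by lia)]
    · intro x
      constructor
      · intro hx
        obtain ⟨y, hy⟩ := h3 ⟨x, hx⟩
        exact ⟨y, congrArg Subtype.val hy⟩
      · rintro ⟨y, rfl⟩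
        exact (ε y).2
    · rintro (_ | i)
      · intro x
        refine Iff.trans ?_ (h4 x)
        exact ⟨fun h => Subtype.ext h, fun h => congrArg Subtype.val h⟩
      · exact h5 i

/-- A finite exact complex of permutation modules is a resolution. -/
theorem of_exact {n : ℕ} (P : ℕ → Type) [∀ i, AddCommGroup (P i)]
    [∀ i, Module (MonoidAlgebra k G) (P i)] (d : ∀ i, P (i + 1) →ₗ[MonoidAlgebra k G] P i)
    (ε : P 0 →ₗ[MonoidAlgebra k G] M) (r : ℕ) (hP : ∀ i, IsPermutationModule k G (P i))
    (hproj : ∀ i < r, Module.Projective (MonoidAlgebra k G) (P i))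
    (hn : ∀ i, n ≤ i → Subsingleton (P i)) (hε : Function.Surjective ε)
    (hdε : Function.Exact (d 0) ε) (hd : ∀ i, Function.Exact (d (i + 1)) (d i)) :
    Res k G r n M := by
  induction n generalizing P r M with
  | zero =>
    have := hn 0 le_rfl
    exact hε.subsingleton
  | succ n ih =>
    refine ⟨P 0, _, _, ε, hP 0, hproj 0, hε, ?_⟩
    refine ih (fun i => P (i + 1)) (fun i => d (i + 1))
      ((d 0).codRestrict _ fun x => (hdε _).2 ⟨x, rfl⟩) (r - 1) (fun i => hP _)
      (fun i hi => hproj _ (by lia)) (fun i hi => hn _ (by lia)) ?_ ?_ (fun i => hd _)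
    · rintro ⟨x, hx⟩
      obtain ⟨y, rfl⟩ := (hdε x).1 hx
      exact ⟨y, rfl⟩
    · intro x
      refine Iff.trans ?_ (hd 0 x)
      exact ⟨fun h => congrArg Subtype.val h, fun h => Subtype.ext h⟩

end Res

end PermRes

namespace PermRes

open Function

/-- A signing of the edges of the hypercube `Y → Bool` for which every square anticommutes. -/
structure SignSystem (k Y : Type) [Field k] [DecidableEq Y] where
  sign : (Y → Bool) → Y → k
  sign_update : ∀ S y v, sign (update S y v) y = sign S y
  sign_mul_self : ∀ S y, sign S y * sign S y = 1
  sign_anticomm : ∀ S y z, y ≠ z → sign S y * sign (update S y (!S y)) z =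
    -(sign S z * sign (update S z (!S z)) y)

/-- A finite complex of based vector spaces with basis `F`, augmented to `k`, together with a
contraction onto `k`. -/
structure BasedComplex (k F : Type) [Field k] [Fintype F] [DecidableEq F] where
  deg : F → ℕ
  d : F → F → k
  aug : F → k
  base : F
  h : F → F → k
  deg_of_d_ne_zero : ∀ b c, d b c ≠ 0 → deg b = deg c + 1
  bodd_of_h_ne_zero : ∀ b c, h b c ≠ 0 → (deg c).bodd = !(deg b).bodd
  d_comp_d : ∀ b c, ∑ x, d b x * d x c = 0
  aug_comp_d : ∀ b, ∑ x, d b x * aug x = 0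
  deg_of_aug_ne_zero : ∀ b, aug b ≠ 0 → deg b = 0
  deg_base : deg base = 0
  aug_base : aug base = 1
  homotopy : ∀ b c, ∑ x, d b x * h x c + ∑ x, h b x * d x c =
    (if b = c then 1 else 0) - aug b * (if c = base then 1 else 0)

set_option linter.unusedSectionVars false

variable {k Y : Type} [Field k] [Fintype Y] [DecidableEq Y] {F : Y → Type}
  [∀ y, Fintype (F y)] [∀ y, DecidableEq (F y)]

section

variable (e : SignSystem k Y) (p : ∀ y, F y → Bool)

/-- The operator on the tensor product of the spaces `F y → k` which is given in one factor by the
matrix `φ`, with Koszul signs. -/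
@[simps]
def factorOp (y : Y) (φ : F y → F y → k) : ((∀ y, F y) → k) →ₗ[k] ((∀ y, F y) → k) where
  toFun f t := e.sign (fun z => p z (t z)) y * ∑ b, φ b (t y) * f (update t y b)
  map_add' f g := by
    ext t
    simp [mul_add, Finset.sum_add_distrib]
  map_smul' c f := by
    ext t
    simp only [Pi.smul_apply, smul_eq_mul, RingHom.id_apply, Finset.mul_sum]
    exact Finset.sum_congr rfl fun b _ => by ring

theorem parity_update (t : ∀ y, F y) (y : Y) (b : F y) :
    (fun z => p z (update t y b z)) = update (fun z => p z (t z)) y (p y b) := by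
  ext z
  by_cases hz : z = y
  · subst hz; simp
  · simp [hz]

theorem factorOp_factorOp_same (y : Y) (φ ψ : F y → F y → k) (f : (∀ y, F y) → k)
    (t : ∀ y, F y) : factorOp e p y φ (factorOp e p y ψ f) t =
      ∑ b, (∑ x, ψ b x * φ x (t y)) * f (update t y b) := by
  simp only [factorOp_apply, parity_update, e.sign_update, update_self, update_idem,
    Finset.mul_sum, Finset.sum_mul]
  rw [Finset.sum_comm]
  refine Finset.sum_congr rfl fun b _ => Finset.sum_congr rfl fun x _ => ?_
  linear_combination (φ x (t y) * ψ b x * f (update t y b)) *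
    e.sign_mul_self (fun z => p z (t z)) y

theorem factorOp_anticomm {y z : Y} (hyz : y ≠ z) (φ : F y → F y → k) (ψ : F z → F z → k)
    (hφ : ∀ b c, φ b c ≠ 0 → p y c = !p y b) (hψ : ∀ b c, ψ b c ≠ 0 → p z c = !p z b)
    (f : (∀ y, F y) → k) :
    factorOp e p y φ (factorOp e p z ψ f) = -factorOp e p z ψ (factorOp e p y φ f) := by
  ext t
  simp only [factorOp_apply, parity_update, Finset.mul_sum, Pi.neg_apply, ne_eq, hyz, Ne.symm hyz,
    not_false_eq_true, update_of_ne]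
  rw [Finset.sum_comm, ← Finset.sum_neg_distrib]
  refine Finset.sum_congr rfl fun c _ => ?_
  rw [← Finset.sum_neg_distrib]
  refine Finset.sum_congr rfl fun b _ => ?_
  rw [update_comm hyz]
  by_cases h1 : φ b (t y) = 0
  · simp [h1]
  by_cases h2 : ψ c (t z) = 0
  · simp [h2]
  have h3 : p y b = !p y (t y) := by simp [hφ _ _ h1]
  have h4 : p z c = !p z (t z) := by simp [hψ _ _ h2]
  rw [h3, h4]
  linear_combination (φ b (t y) * ψ c (t z) * f (update (update t z c) y b)) *
    e.sign_anticomm (fun x => p x (t x)) y z hyz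

end

section

variable (e : SignSystem k Y) (X : ∀ y, BasedComplex k (F y))

/-- The differential of the tensor product of a family of based complexes. -/
def tensorD : ((∀ y, F y) → k) →ₗ[k] ((∀ y, F y) → k) :=
  ∑ y, factorOp e (fun y b => ((X y).deg b).bodd) y (X y).d

/-- The augmentation of the tensor product of a family of based complexes. -/
@[simps]
def tensorAug : ((∀ y, F y) → k) →ₗ[k] k where
  toFun f := ∑ t, (∏ y, (X y).aug (t y)) * f t
  map_add' f g := by simp [mul_add, Finset.sum_add_distrib]
  map_smul' c f := by
    simp only [Pi.smul_apply, smul_eq_mul, RingHom.id_apply, Finset.mul_sum]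
    exact Finset.sum_congr rfl fun b _ => by ring

theorem bodd_of_d_ne_zero {F : Type} [Fintype F] [DecidableEq F] (X : BasedComplex k F) (b c : F)
    (h : X.d b c ≠ 0) : (X.deg c).bodd = !(X.deg b).bodd := by
  simp [X.deg_of_d_ne_zero b c h]

theorem tensorD_tensorD (f : (∀ y, F y) → k) : tensorD e X (tensorD e X f) = 0 := by
  simp only [tensorD, LinearMap.sum_apply, map_sum]
  rw [← Finset.sum_product']
  refine Finset.sum_involution (fun a _ => (a.2, a.1)) ?_ ?_ (by simp) (by simp)
  · rintro ⟨y, z⟩ -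
    by_cases hyz : y = z
    · subst hyz
      have : factorOp e (fun y b => ((X y).deg b).bodd) y (X y).d
          (factorOp e (fun y b => ((X y).deg b).bodd) y (X y).d f) = 0 := by
        ext t
        rw [factorOp_factorOp_same]
        simp [(X y).d_comp_d]
      simp [this]
    · simp only
      rw [factorOp_anticomm _ _ (Ne.symm hyz), neg_add_cancel]
      · exact bodd_of_d_ne_zero (X z)
      · exact bodd_of_d_ne_zero (X y)
  · rintro ⟨y, z⟩ - h1 h2
    obtain rfl : z = y := congrArg Prod.fst h2
    apply h1
    ext t
    rw [factorOp_factorOp_same]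
    simp [(X z).d_comp_d]

/-- The projection of one factor onto its augmentation. -/
@[simps]
def factorProj (y : Y) : ((∀ y, F y) → k) →ₗ[k] ((∀ y, F y) → k) where
  toFun f t := if t y = (X y).base then ∑ b, (X y).aug b * f (update t y b) else 0
  map_add' f g := by
    ext t
    simp only [Pi.add_apply, mul_add, Finset.sum_add_distrib]
    split_ifs <;> simp
  map_smul' c f := by
    ext t
    simp only [Pi.smul_apply, smul_eq_mul, RingHom.id_apply, mul_ite, mul_zero, Finset.mul_sum]
    refine if_congr Iff.rfl (Finset.sum_congr rfl fun b _ => by ring) rfl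

theorem tensorD_factorOp (y : Y) (f : (∀ y, F y) → k) :
    tensorD e X (factorOp e (fun y b => ((X y).deg b).bodd) y (X y).h f) +
      factorOp e (fun y b => ((X y).deg b).bodd) y (X y).h (tensorD e X f) =
        f - factorProj X y f := by
  simp only [tensorD, LinearMap.sum_apply, map_sum, ← Finset.sum_add_distrib]
  rw [Finset.sum_eq_single y]
  · ext t
    rw [Pi.add_apply, factorOp_factorOp_same, factorOp_factorOp_same, ← Finset.sum_add_distrib]
    have : ∀ b ∈ Finset.univ, (∑ x, (X y).h b x * (X y).d x (t y)) * f (update t y b) +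
        (∑ x, (X y).d b x * (X y).h x (t y)) * f (update t y b) =
        ((if b = t y then 1 else 0) - (X y).aug b * (if t y = (X y).base then 1 else 0)) *
          f (update t y b) := fun b _ => by
      linear_combination ((X y).homotopy b (t y)) * f (update t y b)
    rw [Finset.sum_congr rfl this]
    simp only [sub_mul, Finset.sum_sub_distrib, ite_mul, one_mul, zero_mul,
      Finset.sum_ite_eq', Finset.mem_univ, if_true, update_eq_self, factorProj_apply,
      Pi.sub_apply]
    congr 1
    split_ifs <;> simp
  · intro z _ hzy
    rw [factorOp_anticomm _ _ hzy, neg_add_cancel]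
    · exact bodd_of_d_ne_zero (X z)
    · exact (X y).bodd_of_h_ne_zero
  · simp

theorem sum_update_swap (y : Y) (Φ : (∀ y, F y) → F y → k) :
    ∑ t, ∑ b, Φ t b = ∑ t, ∑ b, Φ (update t y b) (t y) := by
  rw [← Finset.sum_product', ← Finset.sum_product']
  refine Finset.sum_nbij' (fun a => (update a.1 y a.2, a.1 y)) (fun a => (update a.1 y a.2, a.1 y))
    ?_ ?_ ?_ ?_ ?_ <;> simp

theorem prod_aug_update (t : ∀ y, F y) (y : Y) (b : F y) :
    ∏ z, (X z).aug (update t y b z) =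
      (X y).aug b * ∏ z ∈ Finset.univ.erase y, (X z).aug (t z) := by
  rw [← Finset.mul_prod_erase _ _ (Finset.mem_univ y), update_self]
  congr 1
  refine Finset.prod_congr rfl fun z hz => ?_
  rw [update_of_ne (Finset.ne_of_mem_erase hz)]

theorem tensorAug_tensorD (f : (∀ y, F y) → k) : tensorAug X (tensorD e X f) = 0 := by
  simp only [tensorD, LinearMap.sum_apply, map_sum]
  refine Finset.sum_eq_zero fun y _ => ?_
  simp only [tensorAug_apply, factorOp_apply, Finset.mul_sum]
  rw [sum_update_swap]
  refine Finset.sum_eq_zero fun t _ => ?_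
  simp only [parity_update (fun y b => ((X y).deg b).bodd), e.sign_update, update_self,
    update_idem, update_eq_self, prod_aug_update]
  calc _ = (∏ z ∈ Finset.univ.erase y, (X z).aug (t z)) *
        e.sign (fun z => ((X z).deg (t z)).bodd) y * f t * ∑ x, (X y).d (t y) x * (X y).aug x := by
        rw [Finset.mul_sum]
        exact Finset.sum_congr rfl fun x _ => by ring
    _ = 0 := by rw [(X y).aug_comp_d, mul_zero]

theorem exists_tensorD_eq {f : (∀ y, F y) → k} (hf : tensorD e X f = 0)
    (hf' : tensorAug X f = 0) : ∃ w, tensorD e X w = f := by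
  have key : ∀ U : Finset Y, ∃ w, ∀ t, (∃ y ∈ U, t y ≠ (X y).base) →
      (f - tensorD e X w) t = 0 := by
    intro U
    induction U using Finset.induction_on with
    | empty => exact ⟨0, by simp⟩
    | insert y U _ ih =>
      obtain ⟨w, hw⟩ := ih
      have h0 : tensorD e X (f - tensorD e X w) = 0 := by
        rw [map_sub, hf, tensorD_tensorD, sub_zero]
      have h1 := tensorD_factorOp e X y (f - tensorD e X w)
      rw [h0, map_zero, add_zero] at h1
      refine ⟨w + factorOp e (fun y b => ((X y).deg b).bodd) y (X y).h (f - tensorD e X w), ?_⟩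
      intro t ht
      have h2 : f - tensorD e X (w + factorOp e (fun y b => ((X y).deg b).bodd) y (X y).h
          (f - tensorD e X w)) = factorProj X y (f - tensorD e X w) := by
        rw [map_add, h1]
        abel
      rw [h2, factorProj_apply]
      split_ifs with hy
      · obtain ⟨z, hz, hzt⟩ := ht
        have hzy : z ≠ y := by
          rintro rfl
          exact hzt hy
        refine Finset.sum_eq_zero fun b _ => ?_
        rw [hw, mul_zero]
        refine ⟨z, (Finset.mem_insert.1 hz).resolve_left hzy, ?_⟩
        rwa [update_of_ne hzy]
      · rfl
  obtain ⟨w, hw⟩ := key Finset.univ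
  refine ⟨w, (sub_eq_zero.1 ?_).symm⟩
  have h0 : tensorAug X (f - tensorD e X w) = 0 := by
    rw [map_sub, hf', tensorAug_tensorD, sub_zero]
  ext t
  by_cases ht : t = fun y => (X y).base
  · rw [tensorAug_apply, Finset.sum_eq_single t] at h0
    · simpa [ht, (X _).aug_base] using h0
    · intro s _ hs
      rw [hw, mul_zero]
      obtain ⟨y, hy⟩ := Function.ne_iff.1 (ht ▸ hs)
      exact ⟨y, Finset.mem_univ _, hy⟩
    · simp
  · obtain ⟨y, hy⟩ := Function.ne_iff.1 ht
    exact hw t ⟨y, Finset.mem_univ _, hy⟩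

end

end PermRes

namespace PermRes

open Function

section

variable (k : Type) {Y : Type} [Field k] [Fintype Y]

/-- The Koszul sign attached to a numbering of the factors. -/
def koszulSign (o : Y → ℕ) (S : Y → Bool) (y : Y) : k :=
  ∏ z, if o z < o y ∧ S z then -1 else 1

theorem koszulSign_mul_self (o : Y → ℕ) (S : Y → Bool) (y : Y) :
    koszulSign k o S y * koszulSign k o S y = 1 := by
  rw [koszulSign, ← Finset.prod_mul_distrib]
  refine Finset.prod_eq_one fun z _ => ?_
  split_ifs <;> simp

variable [DecidableEq Y]

theorem koszulSign_update (o : Y → ℕ) (S : Y → Bool) (y : Y) (v : Bool) :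
    koszulSign k o (update S y v) y = koszulSign k o S y := by
  refine Finset.prod_congr rfl fun z _ => ?_
  by_cases hz : z = y
  · subst hz; simp
  · simp [hz]

theorem koszulSign_flip (o : Y → ℕ) (S : Y → Bool) (y z : Y) :
    koszulSign k o (update S y (!S y)) z = (if o y < o z then -1 else 1) * koszulSign k o S z := by
  rw [koszulSign, koszulSign, ← Finset.mul_prod_erase _ _ (Finset.mem_univ y),
    ← Finset.mul_prod_erase _ (fun x => if o x < o z ∧ S x = true then (-1 : k) else 1)
      (Finset.mem_univ y), ← mul_assoc]
  congr 1
  · cases S y <;> by_cases h : o y < o z <;> simp [h]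
  · refine Finset.prod_congr rfl fun x hx => ?_
    rw [update_of_ne (Finset.ne_of_mem_erase hx)]

theorem exists_signSystem {G : Type} [Group G] [Fintype G] [MulAction G Y]
    (hG : (-1 : k) ^ Fintype.card G = -1) :
    ∃ e : SignSystem k Y, ∀ (g : G) S y, e.sign (fun z => S (g⁻¹ • z)) (g • y) = e.sign S y := by
  let o : Y → ℕ := fun y => Fintype.equivFin Y y
  have ho : Function.Injective o := Fin.val_injective.comp (Fintype.equivFin Y).injective
  have hu : ∀ (g : G) (S : Y → Bool) (y : Y) (v : Bool),
      (fun z => update S y v (g⁻¹ • z)) = update (fun z => S (g⁻¹ • z)) (g • y) v := by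
    intro g S y v
    ext z
    by_cases hz : z = g • y
    · subst hz; simp
    · rw [update_of_ne hz, update_of_ne]
      rintro rfl
      simp at hz
  have hf : ∀ (S : Y → Bool) (y z : Y),
      ∏ g : G, koszulSign k o (fun x => update S y (!S y) (g⁻¹ • x)) (g • z) =
        (∏ g : G, if o (g • y) < o (g • z) then -1 else 1) *
          ∏ g : G, koszulSign k o (fun x => S (g⁻¹ • x)) (g • z) := by
    intro S y z
    rw [← Finset.prod_mul_distrib]
    refine Finset.prod_congr rfl fun g _ => ?_
    rw [hu, ← koszulSign_flip]
    simp
  refine ⟨⟨fun S y => ∏ g : G, koszulSign k o (fun z => S (g⁻¹ • z)) (g • y), ?_, ?_, ?_⟩, ?_⟩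
  · intro S y v
    refine Finset.prod_congr rfl fun g _ => ?_
    rw [hu, koszulSign_update]
  · intro S y
    rw [← Finset.prod_mul_distrib]
    exact Finset.prod_eq_one fun g _ => koszulSign_mul_self k _ _ _
  · intro S y z hyz
    rw [hf, hf]
    have h1 : (∏ g : G, if o (g • y) < o (g • z) then (-1 : k) else 1) =
        ∏ g : G, (-1 : k) * if o (g • z) < o (g • y) then (-1 : k) else 1 := by
      refine Finset.prod_congr rfl fun g _ => ?_
      have : o (g • y) ≠ o (g • z) := fun h => hyz (MulAction.injective g (ho h))
      rcases this.lt_or_gt with h | h <;> simp [h, h.not_gt]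
    rw [h1, Finset.prod_mul_distrib, Finset.prod_const, Finset.card_univ, hG]
    ring
  · intro h S y
    refine Fintype.prod_equiv (Equiv.mulRight h) _ _ fun g => ?_
    simp [mul_smul]

end

end PermRes

namespace PermRes

open Function

section

variable {k F : Type} [Field k] [Fintype F]

/-- The linear map whose matrix coefficient from `b` to `c` is `d b c`. -/
@[simps]
def kernelMap (d : F → F → k) : (F → k) →ₗ[k] (F → k) where
  toFun f c := ∑ b, d b c * f b
  map_add' f g := by
    ext t
    simp [mul_add, Finset.sum_add_distrib]
  map_smul' c f := by
    ext t
    simp only [Pi.smul_apply, smul_eq_mul, RingHom.id_apply, Finset.mul_sum]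
    exact Finset.sum_congr rfl fun b _ => by ring

variable [DecidableEq F]

theorem kernelMap_single (d : F → F → k) (b c : F) : kernelMap d (Pi.single b 1) c = d b c := by
  simp [Pi.single_apply]

/-- A complex of vector spaces which is exact except for an augmentation is contractible onto
the image of the augmentation. -/
theorem exists_contraction {V : Type} [AddCommGroup V] [Module k V] (D π : V →ₗ[k] V)
    (hD : ∀ v, D (D v) = 0) (hπ : ∀ v, π (π v) = π v) (hDπ : ∀ v, D (π v) = 0)
    (hπD : ∀ v, π (D v) = 0) (hex : ∀ v, D v = 0 → π v = 0 → ∃ w, D w = v) :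
    ∃ h : V →ₗ[k] V, ∀ v, h (D v) + D (h v) = v - π v := by
  obtain ⟨s, hs⟩ := D.rangeRestrict.exists_rightInverse_of_surjective D.range_rangeRestrict
  obtain ⟨s', hs'⟩ := s.exists_extend
  let σ : V →ₗ[k] V := (LinearMap.id - π) ∘ₗ s'
  have hσ (v : V) : D (σ (D v)) = D v := by
    have h1 : s' (D v) = s ⟨D v, v, rfl⟩ := LinearMap.congr_fun hs' ⟨D v, v, rfl⟩
    have h2 : D (s ⟨D v, v, rfl⟩) = D v :=
      congrArg Subtype.val (LinearMap.congr_fun hs ⟨D v, v, rfl⟩)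
    simp [σ, hDπ, h1, h2]
  have hπσ (v : V) : π (σ v) = 0 := by simp [σ, hπ]
  refine ⟨σ ∘ₗ (LinearMap.id - σ ∘ₗ D) ∘ₗ (LinearMap.id - π), fun v => ?_⟩
  obtain ⟨w, hw⟩ := hex ((v - π v) - σ (D (v - π v))) (by simp [hσ, hDπ]) (by simp [hπσ, hπ])
  have h1 : D (σ ((v - π v) - σ (D (v - π v)))) = (v - π v) - σ (D (v - π v)) := by
    rw [← hw, hσ]
  simp only [LinearMap.comp_apply, LinearMap.sub_apply, LinearMap.id_apply, h1]
  simp [hπD, hDπ, hD]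

theorem exists_basedComplex (deg : F → ℕ) (d : F → F → k) (aug : F → k) (base : F)
    (deg_of_d_ne_zero : ∀ b c, d b c ≠ 0 → deg b = deg c + 1)
    (d_comp_d : ∀ f, kernelMap d (kernelMap d f) = 0)
    (aug_comp_d : ∀ f, ∑ x, aug x * kernelMap d f x = 0)
    (deg_of_aug_ne_zero : ∀ b, aug b ≠ 0 → deg b = 0)
    (deg_base : deg base = 0) (aug_base : aug base = 1)
    (hcycle : ∀ f, kernelMap d f = 0 → ∑ x, aug x * f x = 0 → ∃ w, kernelMap d w = f) :
    ∃ X : BasedComplex k F, X.deg = deg ∧ X.d = d ∧ X.aug = aug ∧ X.base = base := by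
  let π : (F → k) →ₗ[k] (F → k) := kernelMap fun b c => aug b * if c = base then 1 else 0
  have hπ (f : F → k) (c : F) : π f c = if c = base then ∑ x, aug x * f x else 0 := by
    simp only [π, kernelMap_apply]
    split_ifs <;> simp
  have haug (f : F → k) : ∑ x, aug x * π f x = ∑ x, aug x * f x := by
    simp [hπ, aug_base]
  obtain ⟨h, hh⟩ := exists_contraction (kernelMap d) π d_comp_d
    (fun f => by ext c; rw [hπ, haug, hπ])
    (fun f => by
      ext c
      simp only [kernelMap_apply, hπ, mul_ite, mul_zero, Finset.sum_ite_eq', Finset.mem_univ,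
        if_true, Pi.zero_apply]
      have : d base c = 0 := by
        by_contra hc
        have := deg_of_d_ne_zero _ _ hc
        omega
      simp [this])
    (fun f => by ext c; rw [hπ, aug_comp_d]; simp)
    (fun f h1 h2 => hcycle f h1 (by rw [← haug, h2]; simp))
  have h1 (b c : F) : ∑ x, d b x * h (Pi.single x 1) c + ∑ x, h (Pi.single b 1) x * d x c =
      (if b = c then 1 else 0) - aug b * (if c = base then 1 else 0) := by
    have := congrFun (hh (Pi.single b 1)) c
    rw [Pi.add_apply, Pi.sub_apply, kernelMap_single] at this
    rw [show (Pi.single b (1 : k) : F → k) c = if b = c then 1 else 0 by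
      simp [Pi.single_apply, eq_comm]] at this
    rw [← this]
    congr 1
    · conv_rhs => rw [pi_eq_sum_univ' (kernelMap d (Pi.single b 1))]
      rw [map_sum, Finset.sum_apply]
      refine Finset.sum_congr rfl fun x _ => ?_
      rw [map_smul, kernelMap_single, Pi.smul_apply, smul_eq_mul]
    · simp [mul_comm]
  have hd (b c : F) (hbc : (deg c).bodd ≠ !(deg b).bodd) : d b c = 0 := by
    by_contra hc
    apply hbc
    simp [deg_of_d_ne_zero _ _ hc]
  refine ⟨⟨deg, d, aug, base,
    fun b c => if (deg c).bodd = !(deg b).bodd then h (Pi.single b 1) c else 0,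
    deg_of_d_ne_zero, ?_, ?_, ?_, deg_of_aug_ne_zero, deg_base, aug_base, ?_⟩,
    rfl, rfl, rfl, rfl⟩
  · intro b c hbc
    by_contra hc
    simp [hc] at hbc
  · intro b c
    have := congrFun (d_comp_d (Pi.single b 1)) c
    rw [kernelMap_apply] at this
    simp only [kernelMap_single] at this
    refine Eq.trans ?_ this
    exact Finset.sum_congr rfl fun x _ => mul_comm _ _
  · intro b
    have := aug_comp_d (Pi.single b 1)
    simp only [kernelMap_single] at this
    rw [← this]
    exact Finset.sum_congr rfl fun x _ => mul_comm _ _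
  · intro b c
    by_cases hbc : (deg c).bodd = (deg b).bodd
    · rw [← h1]
      congr 1 <;> refine Finset.sum_congr rfl fun x _ => ?_
      · by_cases hx : (deg x).bodd = !(deg b).bodd
        · simp [hx, hbc]
        · simp [hd _ _ hx]
      · by_cases hx : (deg x).bodd = !(deg b).bodd
        · simp [hx]
        · rw [hd x c, mul_zero, mul_zero]
          simpa [hbc, eq_comm] using hx
    · have hne : b ≠ c := by
        rintro rfl
        exact hbc rfl
      have h2 : aug b * (if c = base then 1 else 0) = 0 := by
        by_contra h3
        obtain ⟨h4, h5⟩ := mul_ne_zero_iff.1 h3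
        have h6 : c = base := by
          by_contra h6
          simp [h6] at h5
        rw [h6, deg_base, deg_of_aug_ne_zero b h4] at hbc
        exact hbc rfl
      rw [if_neg hne, h2, sub_zero, Finset.sum_eq_zero, Finset.sum_eq_zero, add_zero]
      · intro x _
        by_cases hx : (deg x).bodd = !(deg b).bodd
        · rw [hd x c, mul_zero]
          rw [hx]
          simpa using hbc
        · simp [hx]
      · intro x _
        by_cases hx : (deg x).bodd = !(deg b).bodd
        · rw [if_neg, mul_zero]
          rw [hx]
          simpa using hbc
        · simp [hd _ _ hx]

end

end PermRes

namespace PermRes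

set_option linter.unusedSectionVars false

open Function

section

variable (k : Type) [Field k] {C : Type} [Fintype C] [DecidableEq C] (n : ℕ) (τ : Equiv.Perm C)

/-- The degree of a cell of the standard complex of a transitive permutation, truncated by a
single cell in degree `n`. -/
def cellDeg {C : Type} {n : ℕ} : Option (Fin n × C) → ℕ
  | none => n
  | some x => x.1

/-- The differential of the periodic complex of a permutation, truncated in degree `n`. -/
def cellD : Option (Fin n × C) → Option (Fin n × C) → k
  | _, none => 0
  | none, some y => if n = y.1 + 1 then 1 else 0
  | some x, some y => if (x.1 : ℕ) = y.1 + 1 then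
      (if Odd (y.1 : ℕ) then 1 else (if x.2 = τ.symm y.2 then 1 else 0) -
        (if x.2 = y.2 then 1 else 0)) else 0

/-- The augmentation of the periodic complex of a permutation. -/
def cellAug {C : Type} {n : ℕ} (b : Option (Fin n × C)) : k := if cellDeg b = 0 then 1 else 0

variable {k n}

/-- The component in degree `j` of a chain, away from the truncation. -/
def component {C : Type} (f : Option (Fin n × C) → k) (j : ℕ) (x : C) : k :=
  if h : j < n then f (some (⟨j, h⟩, x)) else 0

theorem component_of_lt {C : Type} (f : Option (Fin n × C) → k) {j : ℕ} (h : j < n) (x : C) :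
    component f j x = f (some (⟨j, h⟩, x)) := dif_pos h

theorem deg_of_cellD_ne_zero (b c : Option (Fin n × C)) (h : cellD k n τ b c ≠ 0) :
    cellDeg b = cellDeg c + 1 := by
  rcases b with _ | b <;> rcases c with _ | c <;> simp only [cellD, cellDeg] at h ⊢ <;>
    simp at h <;> tauto

theorem kernelMap_cellD_none (f : Option (Fin n × C) → k) :
    kernelMap (cellD k n τ) f none = 0 := by
  simp [kernelMap, cellD]

theorem kernelMap_cellD_some (hn : Even n) (f : Option (Fin n × C) → k) (j : Fin n) (y : C) :
    kernelMap (cellD k n τ) f (some (j, y)) = if Odd (j : ℕ) then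
      (∑ x, component f (j + 1) x) + if n = j + 1 then f none else 0
      else component f (j + 1) (τ.symm y) - component f (j + 1) y := by
  rw [kernelMap_apply, Fintype.sum_option, Fintype.sum_prod_type]
  have h1 : ∑ i : Fin n, ∑ x : C, cellD k n τ (some (i, x)) (some (j, y)) * f (some (i, x)) =
      ∑ x : C, (if Odd (j : ℕ) then 1 else (if x = τ.symm y then 1 else 0) -
        (if x = y then 1 else 0)) * component f (j + 1) x := by
    by_cases hj : (j : ℕ) + 1 < n
    · rw [Finset.sum_eq_single ⟨j + 1, hj⟩]
      · simp [cellD, component_of_lt _ hj]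
      · intro i _ hi
        refine Finset.sum_eq_zero fun x _ => ?_
        simp only [cellD]
        rw [if_neg (fun h => hi (Fin.ext h)), zero_mul]
      · simp
    · rw [Finset.sum_eq_zero]
      · simp [component, hj]
      · intro i _
        refine Finset.sum_eq_zero fun x _ => ?_
        simp only [cellD]
        rw [if_neg (by omega), zero_mul]
  rw [h1]
  split_ifs with h2 h3
  · simp [cellD, ← h3, add_comm]
  · simp [cellD, h3]
  · simp only [sub_mul, Finset.sum_sub_distrib, cellD]
    simp
    intro h
    exfalso
    grind

theorem kernelMap_cellD_kernelMap_cellD (hn : Even n) (f : Option (Fin n × C) → k) :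
    kernelMap (cellD k n τ) (kernelMap (cellD k n τ) f) = 0 := by
  ext (_ | ⟨j, y⟩)
  · exact kernelMap_cellD_none τ _
  · rw [kernelMap_cellD_some τ hn, kernelMap_cellD_none, ite_self, add_zero, Pi.zero_apply]
    by_cases hj : (j : ℕ) + 1 < n
    · simp only [component_of_lt _ hj, kernelMap_cellD_some τ hn]
      rcases Nat.even_or_odd (j : ℕ) with h1 | h1
      · simp [h1.add_one, Nat.not_odd_iff_even.2 h1]
      · simp only [h1, Nat.not_odd_iff_even.2 h1.add_one, if_true, if_false,
          Finset.sum_sub_distrib, sub_eq_zero]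
        exact Equiv.sum_comp τ.symm _
    · simp [component, hj]

theorem sum_cellAug (hn : 0 < n) (f : Option (Fin n × C) → k) :
    ∑ b, cellAug k b * f b = ∑ x, component f 0 x := by
  rw [Fintype.sum_option, Fintype.sum_prod_type, Finset.sum_eq_single ⟨0, hn⟩]
  · simp [cellAug, cellDeg, hn.ne', component_of_lt f hn]
  · intro i _ hi
    refine Finset.sum_eq_zero fun x _ => ?_
    have : (i : ℕ) ≠ 0 := fun h => hi (Fin.ext h)
    simp [cellAug, cellDeg, this]
  · simp

theorem sum_cellAug_cellD (hn : Even n) (hn' : 0 < n) (f : Option (Fin n × C) → k) :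
    ∑ b, cellAug k b * kernelMap (cellD k n τ) f b = 0 := by
  rw [sum_cellAug hn']
  simp only [component_of_lt _ hn', kernelMap_cellD_some τ hn]
  simp only [Nat.not_odd_zero, if_false, Finset.sum_sub_distrib, sub_eq_zero]
  exact Equiv.sum_comp τ.symm _

theorem eq_of_comp_symm_eq (hτ : ∀ x y, ∃ m : ℕ, (τ ^ m) x = y)
    (f : C → k) (hf : ∀ y, f (τ.symm y) - f y = 0) (x y : C) :
    f x = f y := by
  obtain ⟨m, rfl⟩ := hτ x y
  induction m with
  | zero => rfl
  | succ m ih =>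
    have := hf ((τ ^ (m + 1)) x)
    rw [pow_succ'] at this ⊢
    simp only [Equiv.Perm.mul_apply, Equiv.symm_apply_apply] at this ⊢
    rw [ih, sub_eq_zero.1 this]

theorem exists_comp_symm_sub_eq (hτ : ∀ x y, ∃ m : ℕ, (τ ^ m) x = y)
    (f : C → k) (hf : ∑ x, f x = 0) :
    ∃ u : C → k, ∀ y, u (τ.symm y) - u y = f y := by
  let T : (C → k) →ₗ[k] (C → k) := LinearMap.funLeft k k τ.symm - LinearMap.id
  suffices f ∈ LinearMap.range T by
    obtain ⟨u, hu⟩ := this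
    exact ⟨u, fun y => congrFun hu y⟩
  rcases isEmpty_or_nonempty C with hC | ⟨⟨x₀⟩⟩
  · exact ⟨0, Subsingleton.elim _ _⟩
  have h1 (m : ℕ) : Pi.single ((τ ^ m) x₀) 1 - Pi.single x₀ 1 ∈ LinearMap.range T := by
    induction m with
    | zero => simp
    | succ m ih =>
      have : Pi.single ((τ ^ (m + 1)) x₀) 1 - Pi.single ((τ ^ m) x₀) 1 ∈ LinearMap.range T := by
        refine ⟨Pi.single ((τ ^ m) x₀) 1, ?_⟩
        ext y
        simp [T, LinearMap.funLeft_apply, Pi.single_apply, pow_succ', Equiv.symm_apply_eq]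
      simpa using add_mem this ih
  have h2 : f = ∑ x, f x • (Pi.single x 1 - Pi.single x₀ 1) := by
    simp only [smul_sub, Finset.sum_sub_distrib, ← Finset.sum_smul, hf, zero_smul, sub_zero]
    exact (pi_eq_sum_univ' f).trans (Finset.sum_congr rfl fun x _ => by
      congr 1)
  rw [h2]
  refine sum_mem fun x _ => Submodule.smul_mem _ _ ?_
  obtain ⟨m, rfl⟩ := hτ x₀ x
  exact h1 m

theorem exists_kernelMap_cellD_eq [Nonempty C]
    (hτ : ∀ x y, ∃ m : ℕ, (τ ^ m) x = y) (hn : Even n) (hn' : 0 < n)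
    (f : Option (Fin n × C) → k) (hf : kernelMap (cellD k n τ) f = 0)
    (hf' : ∑ b, cellAug k b * f b = 0) : ∃ w, kernelMap (cellD k n τ) w = f := by
  obtain ⟨x₀⟩ := ‹Nonempty C›
  have hodd (j : ℕ) (hj : Odd j) (x y : C) : component f j x = component f j y := by
    by_cases h : j < n
    · refine eq_of_comp_symm_eq τ hτ _ (fun z => ?_) x y
      obtain ⟨i, rfl⟩ : ∃ i, j = i + 1 := ⟨j - 1, by have := hj.pos; omega⟩
      have := congrFun hf (some (⟨i, by omega⟩, z))
      rwa [kernelMap_cellD_some τ hn, if_neg (by grind)] at this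
    · simp [component, h]
  have heven (j : ℕ) (hj : Even j) : ∃ u : C → k, ∀ y, u (τ.symm y) - u y = component f j y := by
    refine exists_comp_symm_sub_eq τ hτ _ ?_
    rcases Nat.eq_zero_or_pos j with rfl | h0
    · rwa [← sum_cellAug hn']
    by_cases h : j < n
    · obtain ⟨i, rfl⟩ : ∃ i, j = i + 1 := ⟨j - 1, by omega⟩
      have := congrFun hf (some (⟨i, by omega⟩, x₀))
      rwa [kernelMap_cellD_some τ hn, if_pos (by grind), if_neg (by simp; omega), add_zero] at this
    · simp [component, h]
  choose! u hu using heven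
  have hnone : f none = 0 := by
    have := congrFun hf (some (⟨n - 1, by omega⟩, x₀))
    rw [kernelMap_cellD_some τ hn, if_pos (by grind), if_pos (by simp; omega)] at this
    rw [Finset.sum_eq_zero fun x _ => by simp [component]; omega, zero_add] at this
    exact this
  let w : Option (Fin n × C) → k := fun b => match b with
    | none => component f (n - 1) x₀
    | some (j, x) => if Even (j : ℕ) then (if x = x₀ then component f (j - 1) x₀ else 0)
        else u (j - 1) x
  refine ⟨w, ?_⟩
  ext (_ | ⟨j, y⟩)
  · rw [kernelMap_cellD_none, hnone]
  · rw [kernelMap_cellD_some τ hn]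
    have hj : f (some (j, y)) = component f j y := by rw [component_of_lt _ j.2]
    rw [hj]
    split_ifs with h1 h2
    · rw [Finset.sum_eq_zero, zero_add]
      · simp only [w]
        rw [show n - 1 = j by omega]
        exact hodd _ h1 _ _
      · intro x _
        rw [component, dif_neg (by omega)]
    · have h3 : (j : ℕ) + 1 < n := by omega
      simp only [component_of_lt w h3, w]
      rw [add_zero]
      simp only [if_pos h1.add_one, Nat.add_sub_cancel, Finset.sum_ite_eq', Finset.mem_univ,
        if_true]
      exact hodd _ h1 _ _
    · have h3 : (j : ℕ) + 1 < n := by grind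
      simp only [component_of_lt w h3, w]
      rw [if_neg (by grind), if_neg (by grind), Nat.add_sub_cancel]
      exact hu _ (by grind) _

/-- The truncated periodic complex of a transitive permutation. -/
theorem exists_cellComplex [Nonempty C]
    (hτ : ∀ x y, ∃ m : ℕ, (τ ^ m) x = y) (hn : Even n) (hn' : 0 < n) :
    ∃ X : BasedComplex k (Option (Fin n × C)),
      X.deg = cellDeg ∧ X.d = cellD k n τ ∧ X.aug = cellAug k := by
  obtain ⟨X, h1, h2, h3, -⟩ := exists_basedComplex cellDeg (cellD k n τ) (cellAug k)
    (some (⟨0, hn'⟩, Classical.arbitrary C)) (deg_of_cellD_ne_zero τ)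
    (kernelMap_cellD_kernelMap_cellD τ hn) (sum_cellAug_cellD τ hn hn')
    (fun b hb => by by_contra h; simp [cellAug, h] at hb) rfl (by simp [cellAug, cellDeg])
    (exists_kernelMap_cellD_eq τ hτ hn hn')
  exact ⟨X, h1, h2, h3⟩

end

end PermRes

namespace PermRes

open MonoidAlgebra

section

variable {k G X : Type} [Field k] [Group G] [MulAction G X]

theorem asModuleEquiv_single_smul (g : G) (c : k) (v : (funRep k G X).asModule) (x : X) :
    (funRep k G X).asModuleEquiv (single g c • v) x =
      c * (funRep k G X).asModuleEquiv v (g⁻¹ • x) := by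
  rw [Representation.single_smul]
  rfl

theorem isPermutationModule_funRep [Finite X] :
    IsPermutationModule k G (funRep k G X).asModule :=
  isPermutationModule_of_addEquiv (funRep k G X).asModuleEquiv.toAddEquiv
    fun g c v x => asModuleEquiv_single_smul g c v x

theorem projective_funRep [Finite X] (hX : ∀ (g : G) (x : X), g • x = x → g = 1) :
    Module.Projective (MonoidAlgebra k G) (funRep k G X).asModule := by
  classical
  have := Fintype.ofFinite X
  let ρ := funRep k G X
  refine Module.Projective.of_lifting_property'' fun q hq => ?_
  let rep : X → X := fun x => (Quotient.mk (MulAction.orbitRel G X) x).out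
  have hrep (x : X) : ∃ g : G, g • rep x = x :=
    (MulAction.orbitRel_apply.1 (Setoid.symm' _ (Quotient.mk_out (s := MulAction.orbitRel G X) x)))
  have hrep' (g : G) (x : X) : rep (g • x) = rep x := by
    have : Quotient.mk (MulAction.orbitRel G X) (g • x) =
        Quotient.mk (MulAction.orbitRel G X) x :=
      Quotient.sound (MulAction.orbitRel_apply.2 ⟨g, rfl⟩)
    simp only [rep, this]
  choose γ hγ using hrep
  have hγ' (g : G) (x : X) : γ (g • x) = g * γ x := by
    have : ((g * γ x)⁻¹ * γ (g • x)) • rep x = rep x := by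
      rw [mul_smul, inv_smul_eq_iff, mul_smul, hγ]
      conv_lhs => rw [← hrep' g, hγ]
    exact (inv_mul_eq_one.1 (hX _ _ this)).symm
  choose m hm using fun x => hq (ρ.asModuleEquiv.symm (Pi.single x 1))
  let s : ρ.asModule →+ (ρ.asModule →₀ MonoidAlgebra k G) :=
    { toFun := fun f => ∑ x, single (γ x) (ρ.asModuleEquiv f x) • m (rep x)
      map_zero' := by simp
      map_add' := by
        intro f g
        simp [MonoidAlgebra.single_add, add_smul, Finset.sum_add_distrib] }
  refine ⟨linearMapOfSingle s ?_, ?_⟩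
  · intro g c f
    change ∑ x, single (γ x) (ρ.asModuleEquiv (single g c • f) x) • m (rep x) =
      single g c • ∑ x, single (γ x) (ρ.asModuleEquiv f x) • m (rep x)
    rw [Finset.smul_sum, ← Equiv.sum_comp (MulAction.toPerm g)]
    refine Finset.sum_congr rfl fun x _ => ?_
    rw [MulAction.toPerm_apply, asModuleEquiv_single_smul, inv_smul_smul, hrep', hγ', smul_smul,
      MonoidAlgebra.single_mul_single]
  · ext1 f
    change q (∑ x, single (γ x) (ρ.asModuleEquiv f x) • m (rep x)) = f
    apply ρ.asModuleEquiv.injective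
    rw [map_sum, map_sum]
    ext z
    rw [Finset.sum_apply]
    simp_rw [map_smul, hm]
    have (x : X) : ρ.asModuleEquiv (single (γ x) (ρ.asModuleEquiv f x) •
        ρ.asModuleEquiv.symm (Pi.single (rep x) 1)) z = if x = z then ρ.asModuleEquiv f x else 0 := by
      rw [asModuleEquiv_single_smul, LinearEquiv.apply_symm_apply, Pi.single_apply]
      have : (γ x)⁻¹ • z = rep x ↔ x = z := by
        rw [inv_smul_eq_iff, hγ, eq_comm]
      simp [this]
    rw [Finset.sum_congr rfl fun x _ => this x]
    simp

end

section

variable {k G Ω : Type} [Field k] [Group G] [MulAction G Ω]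

/-- Extension by zero of functions defined on the elements of degree `i`. -/
def extendZero {k Ω : Type} [Field k] (deg : Ω → ℕ) (i : ℕ) :
    ({t // deg t = i} → k) →ₗ[k] (Ω → k) where
  toFun f t := if h : deg t = i then f ⟨t, h⟩ else 0
  map_add' f g := by
    ext t
    by_cases h : deg t = i <;> simp [h]
  map_smul' c f := by
    ext t
    by_cases h : deg t = i <;> simp [h]

theorem extendZero_coe (deg : Ω → ℕ) (i : ℕ) (f : {t // deg t = i} → k) (t : {t // deg t = i}) :
    extendZero deg i f t = f t := dif_pos t.2

theorem extendZero_of_ne (deg : Ω → ℕ) (i : ℕ) (f : {t // deg t = i} → k) {t : Ω}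
    (h : deg t ≠ i) : extendZero deg i f t = 0 := dif_neg h

/-- The action on the elements of degree `i` of a graded `G`-set. -/
abbrev levelAction (deg : Ω → ℕ) (hdeg : ∀ (g : G) t, deg (g • t) = deg t) (i : ℕ) :
    MulAction G {t // deg t = i} where
  smul g t := ⟨g • t.1, (hdeg g t.1).trans t.2⟩
  one_smul t := Subtype.ext (one_smul G t.1)
  mul_smul g h t := Subtype.ext (mul_smul g h t.1)

theorem exists_res_of_graded [Finite Ω] (deg : Ω → ℕ)
    (hdeg : ∀ (g : G) t, deg (g • t) = deg t) (D : (Ω → k) →ₗ[k] (Ω → k)) (ε : (Ω → k) →ₗ[k] k)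
    (hDG : ∀ (g : G) f t, D (fun s => f (g • s)) t = D f (g • t))
    (hεG : ∀ (g : G) f, ε (fun s => f (g • s)) = ε f)
    (hDdeg : ∀ f t, (∀ s, deg s = deg t + 1 → f s = 0) → D f t = 0)
    (hεdeg : ∀ f, (∀ s, deg s = 0 → f s = 0) → ε f = 0)
    (hDD : ∀ f, D (D f) = 0) (hεD : ∀ f, ε (D f) = 0)
    (hex : ∀ f, D f = 0 → ε f = 0 → ∃ w, D w = f) (hε : Function.Surjective ε)
    (r : ℕ) (hfree : ∀ t, deg t < r → ∀ g : G, g • t = t → g = 1)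
    {K : Type} [AddCommGroup K] [Module (MonoidAlgebra k G) K] (κ : k ≃+ K)
    (hκ : ∀ (g : G) (c x : k), κ (c * x) = single g c • κ x) :
    ∃ n, Res k G r n K := by
  let _ (i : ℕ) : MulAction G {t // deg t = i} := levelAction deg hdeg i
  let ρ (i : ℕ) := funRep k G {t // deg t = i}
  let E (i : ℕ) : (ρ i).asModule → (Ω → k) := fun f => extendZero deg i ((ρ i).asModuleEquiv f)
  have hD0 (i : ℕ) (f : (ρ (i + 1)).asModule) (t : Ω) (ht : deg t ≠ i) : D (E (i + 1) f) t = 0 :=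
    hDdeg _ _ fun s hs => extendZero_of_ne _ _ _ (by omega)
  have hEsmul (i : ℕ) (g : G) (c : k) (f : (ρ i).asModule) :
      E i (single g c • f) = c • fun s => E i f (g⁻¹ • s) := by
    ext t
    by_cases ht : deg t = i
    · have h1 := extendZero_coe deg i ((ρ i).asModuleEquiv (single g c • f)) ⟨t, ht⟩
      have h2 := extendZero_coe deg i ((ρ i).asModuleEquiv f) (g⁻¹ • ⟨t, ht⟩)
      rw [asModuleEquiv_single_smul] at h1
      rw [← h2] at h1
      exact h1
    · have h1 := extendZero_of_ne deg i ((ρ i).asModuleEquiv (single g c • f)) ht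
      have h2 : E i f (g⁻¹ • t) = 0 := extendZero_of_ne deg i _ (by rwa [hdeg])
      rw [Pi.smul_apply, h2, smul_zero]
      exact h1
  let d (i : ℕ) : (ρ (i + 1)).asModule →ₗ[MonoidAlgebra k G] (ρ i).asModule :=
    linearMapOfSingle
      { toFun := fun f => (ρ i).asModuleEquiv.symm fun t => D (E (i + 1) f) t
        map_zero' := by
          apply (ρ i).asModuleEquiv.injective
          ext t
          simp [E]
        map_add' := fun f g => by
          apply (ρ i).asModuleEquiv.injective
          ext t
          simp [E] }
      (by
        intro g c f
        apply (ρ i).asModuleEquiv.injective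
        ext t
        rw [asModuleEquiv_single_smul]
        change D (E (i + 1) (single g c • f)) t = c * D (E (i + 1) f) (g⁻¹ • t.1)
        rw [hEsmul, map_smul, ← hDG]
        rfl)
  have hd (i : ℕ) (f : (ρ (i + 1)).asModule) : E i (d i f) = D (E (i + 1) f) := by
    ext t
    by_cases ht : deg t = i
    · exact extendZero_coe deg i _ ⟨t, ht⟩
    · rw [hD0 _ _ _ ht]
      exact extendZero_of_ne deg i _ ht
  let ε' : (ρ 0).asModule →ₗ[MonoidAlgebra k G] K := linearMapOfSingle
    { toFun := fun f => κ (ε (E 0 f))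
      map_zero' := by simp [E]
      map_add' := fun f g => by simp [E] }
    (by
      intro g c f
      change κ (ε (E 0 (single g c • f))) = single g c • κ (ε (E 0 f))
      rw [hEsmul, map_smul, hεG, ← hκ]
      rfl)
  have hEinj (i : ℕ) : Function.Injective (E i) := by
    intro f f' h
    apply (ρ i).asModuleEquiv.injective
    ext t
    have h1 : extendZero deg i ((ρ i).asModuleEquiv f) t =
      extendZero deg i ((ρ i).asModuleEquiv f') t := congrFun h t
    rwa [extendZero_coe, extendZero_coe] at h1
  have hE0 (i : ℕ) : E i 0 = 0 := by simp [E]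
  let R (i : ℕ) (w : Ω → k) : (ρ i).asModule := (ρ i).asModuleEquiv.symm fun t => w t
  have hER (i : ℕ) (w : Ω → k) (t : Ω) (ht : deg t = i) : E i (R i w) t = w t :=
    extendZero_coe deg i _ ⟨t, ht⟩
  have hdR (i : ℕ) (w : Ω → k) (f : (ρ i).asModule) (hw : D w = E i f) :
      d i (R (i + 1) w) = f := by
    apply hEinj
    rw [hd, ← hw, ← sub_eq_zero, ← map_sub]
    ext t
    by_cases ht : deg t = i
    · exact hDdeg _ _ fun s hs => by simp [hER (i + 1) w s (by omega)]
    · rw [map_sub, Pi.sub_apply, hD0 _ _ _ ht, hw]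
      simp [E, extendZero_of_ne deg i _ ht]
  have hmem (i : ℕ) (f : (ρ (i + 1)).asModule) (h : d i f = 0) : D (E (i + 1) f) = 0 := by
    rw [← hd, h, hE0]
  obtain ⟨N, hN⟩ : ∃ N, ∀ t, deg t < N := by
    obtain ⟨N, hN⟩ := (Set.finite_range deg).bddAbove
    exact ⟨N + 1, fun t => Nat.lt_succ_of_le (hN ⟨t, rfl⟩)⟩
  refine ⟨N, Res.of_exact (fun i => (ρ i).asModule) d ε' r (fun i => isPermutationModule_funRep)
    ?_ ?_ ?_ ?_ ?_⟩
  · intro i hi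
    exact projective_funRep fun g t ht =>
      hfree t.1 (t.2.trans_lt hi) g (congrArg Subtype.val ht)
  · intro i hi
    have : IsEmpty {t // deg t = i} := ⟨fun t => by have := hN t.1; have := t.2; omega⟩
    exact (ρ i).asModuleEquiv.injective.subsingleton
  · intro x
    obtain ⟨w, hw⟩ := hε (κ.symm x)
    refine ⟨R 0 w, ?_⟩
    change κ (ε (E 0 (R 0 w))) = x
    have : ε (E 0 (R 0 w)) = ε w := by
      rw [← sub_eq_zero, ← map_sub]
      exact hεdeg _ fun s hs => by simp [hER 0 w s hs]
    rw [this, hw, AddEquiv.apply_symm_apply]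
  · intro f
    constructor
    · intro h
      have h0 : D (E 0 f) = 0 := by
        ext t
        exact hDdeg _ _ fun s hs => extendZero_of_ne _ _ _ (by omega)
      obtain ⟨w, hw⟩ := hex (E 0 f) h0 (κ.map_eq_zero_iff.1 h)
      exact ⟨_, hdR 0 w f hw⟩
    · rintro ⟨w, rfl⟩
      change κ (ε (E 0 (d 0 w))) = 0
      rw [hd, hεD, map_zero]
  · intro i f
    constructor
    · intro h
      obtain ⟨w, hw⟩ := hex (E (i + 1) f) (hmem i f h)
        (hεdeg _ fun s hs => extendZero_of_ne _ _ _ (by omega))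
      exact ⟨_, hdR (i + 1) w f hw⟩
    · rintro ⟨w, rfl⟩
      apply hEinj
      rw [hd, hd, hDD, hE0]

end

end PermRes

namespace PermRes

open Function MonoidAlgebra

set_option linter.unusedSectionVars false

section

variable {k Y G : Type} [Field k] [Fintype Y] [DecidableEq Y] {F : Y → Type}
  [∀ y, Fintype (F y)] [∀ y, DecidableEq (F y)] (e : SignSystem k Y)
  (X : ∀ y, BasedComplex k (F y))

/-- The total degree of a basis element of a tensor product. -/
def tensorDeg (t : ∀ y, F y) : ℕ := ∑ y, (X y).deg (t y)

theorem tensorDeg_update {t : ∀ y, F y} {y : Y} {b : F y}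
    (h : (X y).deg b = (X y).deg (t y) + 1) :
    tensorDeg X (update t y b) = tensorDeg X t + 1 := by
  rw [tensorDeg, tensorDeg, ← Finset.add_sum_erase _ _ (Finset.mem_univ y),
    ← Finset.add_sum_erase _ (fun y => (X y).deg (t y)) (Finset.mem_univ y), update_self, h,
    Finset.sum_congr rfl fun z hz => by rw [update_of_ne (Finset.ne_of_mem_erase hz)]]
  ring

theorem tensorD_apply_eq_zero (f : (∀ y, F y) → k) (t : ∀ y, F y)
    (hf : ∀ s, tensorDeg X s = tensorDeg X t + 1 → f s = 0) : tensorD e X f t = 0 := by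
  simp only [tensorD, LinearMap.sum_apply, Finset.sum_apply, factorOp_apply]
  refine Finset.sum_eq_zero fun y _ => mul_eq_zero_of_right _ (Finset.sum_eq_zero fun b _ => ?_)
  by_cases h : (X y).d b (t y) = 0
  · rw [h, zero_mul]
  · rw [hf _ (tensorDeg_update X ((X y).deg_of_d_ne_zero _ _ h)), mul_zero]

theorem tensorAug_eq_zero (f : (∀ y, F y) → k) (hf : ∀ s, tensorDeg X s = 0 → f s = 0) :
    tensorAug X f = 0 := by
  rw [tensorAug_apply]
  refine Finset.sum_eq_zero fun t _ => ?_
  by_cases h : ∏ y, (X y).aug (t y) = 0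
  · rw [h, zero_mul]
  · rw [hf, mul_zero]
    rw [Finset.prod_eq_zero_iff] at h
    push Not at h
    exact Finset.sum_eq_zero fun y hy => (X y).deg_of_aug_ne_zero _ (h y hy)

theorem tensorAug_surjective : Surjective (tensorAug X) := by
  intro c
  refine ⟨Pi.single (fun y => (X y).base) c, ?_⟩
  rw [tensorAug_apply, Finset.sum_eq_single fun y => (X y).base]
  · simp [(X _).aug_base]
  · intro t _ ht
    rw [Pi.single_eq_of_ne ht, mul_zero]
  · simp

variable [Group G] [MulAction G Y] [MulAction G (∀ y, F y)]
  (a : ∀ (g : G) (y : Y), F (g⁻¹ • y) ≃ F y)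

theorem tensorDeg_smul
    (ha : ∀ (g : G) (t : ∀ y, F y) (y : Y), (g • t) y = a g y (t (g⁻¹ • y)))
    (hdeg : ∀ g y b, (X y).deg (a g y b) = (X (g⁻¹ • y)).deg b) (g : G)
    (t : ∀ y, F y) : tensorDeg X (g • t) = tensorDeg X t := by
  simp only [tensorDeg, ha, hdeg]
  exact Equiv.sum_comp (MulAction.toPerm g⁻¹) fun y => (X y).deg (t y)

theorem tensorAug_smul
    (ha : ∀ (g : G) (t : ∀ y, F y) (y : Y), (g • t) y = a g y (t (g⁻¹ • y)))
    (haug : ∀ g y b, (X y).aug (a g y b) = (X (g⁻¹ • y)).aug b) (g : G)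
    (f : (∀ y, F y) → k) : tensorAug X (fun t => f (g • t)) = tensorAug X f := by
  rw [tensorAug_apply, tensorAug_apply]
  conv_rhs => rw [← Equiv.sum_comp (MulAction.toPerm g)]
  refine Finset.sum_congr rfl fun t _ => ?_
  simp only [MulAction.toPerm_apply, ha, haug]
  congr 1
  exact (Equiv.prod_comp (MulAction.toPerm g⁻¹) fun y => (X y).aug (t y)).symm

theorem tensorD_smul
    (ha : ∀ (g : G) (t : ∀ y, F y) (y : Y), (g • t) y = a g y (t (g⁻¹ • y)))
    (he : ∀ (g : G) S y, e.sign (fun z => S (g⁻¹ • z)) (g • y) = e.sign S y)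
    (hdeg : ∀ g y b, (X y).deg (a g y b) = (X (g⁻¹ • y)).deg b)
    (hd : ∀ g y b c, (X y).d (a g y b) (a g y c) = (X (g⁻¹ • y)).d b c) (g : G)
    (f : (∀ y, F y) → k) (t : ∀ y, F y) :
    tensorD e X (fun t => f (g • t)) t = tensorD e X f (g • t) := by
  simp only [tensorD, LinearMap.sum_apply, Finset.sum_apply, factorOp_apply]
  refine (Fintype.sum_equiv (MulAction.toPerm g⁻¹) _ _ fun y => ?_).symm
  change _ = e.sign (fun z => ((X z).deg (t z)).bodd) (g⁻¹ • y) *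
    ∑ b, (X (g⁻¹ • y)).d b (t (g⁻¹ • y)) * f (g • update t (g⁻¹ • y) b)
  simp only [ha, hdeg]
  congr 1
  · rw [← he g _ (g⁻¹ • y), smul_inv_smul]
  · refine (Fintype.sum_equiv (a g y) _ _ fun b => ?_).symm
    rw [hd]
    congr 2
    ext z
    rw [ha]
    by_cases hz : z = y
    · subst hz
      simp
    · rw [update_of_ne hz, update_of_ne (fun h => hz (MulAction.injective g⁻¹ h)), ha]

end

section

variable (G : Type) [Group G]

/-- The cosets of the cyclic subgroups of `G`. -/
abbrev CyclicCoset := Σ z : G, G ⧸ Subgroup.zpowers z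

variable {G}

/-- The elements of a coset. -/
abbrev CosetElt (y : CyclicCoset G) := {g : G // (g : G ⧸ Subgroup.zpowers y.1) = y.2}

/-- Right multiplication by `z` on a coset of the subgroup generated by `z`. -/
@[simps]
def cosetPerm (y : CyclicCoset G) : Equiv.Perm (CosetElt y) where
  toFun g := ⟨g.1 * y.1, (QuotientGroup.mk_mul_of_mem _ (Subgroup.mem_zpowers _)).trans g.2⟩
  invFun g := ⟨g.1 * y.1⁻¹,
    (QuotientGroup.mk_mul_of_mem _ (inv_mem (Subgroup.mem_zpowers _))).trans g.2⟩
  left_inv g := by simp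
  right_inv g := by simp

theorem cosetPerm_pow_apply (y : CyclicCoset G) (m : ℕ) (g : CosetElt y) :
    ((cosetPerm y ^ m) g).1 = g.1 * y.1 ^ m := by
  induction m with
  | zero => simp
  | succ m ih => rw [pow_succ', Equiv.Perm.mul_apply, cosetPerm_apply_coe, ih, pow_succ, mul_assoc]

theorem exists_cosetPerm_pow [Finite G] (y : CyclicCoset G) (g h : CosetElt y) :
    ∃ m : ℕ, (cosetPerm y ^ m) g = h := by
  have h1 : (g.1)⁻¹ * h.1 ∈ Subgroup.zpowers y.1 := QuotientGroup.eq.1 (g.2.trans h.2.symm)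
  rw [← mem_powers_iff_mem_zpowers] at h1
  obtain ⟨m, hm⟩ := h1
  refine ⟨m, Subtype.ext ?_⟩
  rw [cosetPerm_pow_apply]
  simp only at hm
  rw [hm, mul_inv_cancel_left]

/-- Left multiplication by `g`, as a map between cosets. -/
@[simps]
def cosetShift (g : G) (y : CyclicCoset G) : CosetElt (g⁻¹ • y) ≃ CosetElt y where
  toFun x := ⟨g * x.1, (congrArg (g • ·) x.2).trans (smul_inv_smul g y.2)⟩
  invFun x := ⟨g⁻¹ * x.1, congrArg (g⁻¹ • ·) x.2⟩
  left_inv x := by simp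
  right_inv x := by simp

/-- The action of `g` on the cells of the complexes attached to the cosets. -/
def cellShift (n : ℕ) (g : G) (y : CyclicCoset G) :
    Option (Fin n × CosetElt (g⁻¹ • y)) ≃ Option (Fin n × CosetElt y) :=
  ((Equiv.refl _).prodCongr (cosetShift g y)).optionCongr

/-- The embedding of the cells over a coset into the union of all cells. -/
def cellIncl (n : ℕ) (y : CyclicCoset G) : Option (Fin n × CosetElt y) → Option (Fin n × G) :=
  Option.map (Prod.map id Subtype.val)

theorem cellIncl_injective (n : ℕ) (y : CyclicCoset G) : Injective (cellIncl n y) :=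
  Option.map_injective (injective_id.prodMap Subtype.val_injective)

theorem cellIncl_cellShift (n : ℕ) (g : G) (y : CyclicCoset G)
    (b : Option (Fin n × CosetElt (g⁻¹ • y))) :
    cellIncl n y (cellShift n g y b) =
      Option.map (Prod.map id (g * ·)) (cellIncl n (g⁻¹ • y) b) := by
  cases b <;> rfl

theorem cellIncl_congr {n : ℕ} (t : ∀ y : CyclicCoset G, Option (Fin n × CosetElt y))
    {y y' : CyclicCoset G} (h : y = y') : cellIncl n y (t y) = cellIncl n y' (t y') := by
  subst h
  rfl

/-- The action of `G` on the basis of the tensor product of the complexes attached to the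
cosets of the cyclic subgroups. -/
abbrev cellAction (G : Type) [Group G] (n : ℕ) :
    MulAction G (∀ y : CyclicCoset G, Option (Fin n × CosetElt y)) where
  smul g t y := cellShift n g y (t (g⁻¹ • y))
  one_smul t := by
    ext1 y
    apply cellIncl_injective
    change cellIncl n y (cellShift n 1 y (t (1⁻¹ • y))) = _
    rw [cellIncl_cellShift, cellIncl_congr t (show (1 : G)⁻¹ • y = y by simp)]
    simp [Prod.map_def]
  mul_smul g h t := by
    ext1 y
    apply cellIncl_injective
    change cellIncl n y (cellShift n (g * h) y (t ((g * h)⁻¹ • y))) =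
      cellIncl n y (cellShift n g y (cellShift n h (g⁻¹ • y) (t (h⁻¹ • g⁻¹ • y))))
    rw [cellIncl_cellShift, cellIncl_cellShift, cellIncl_cellShift,
      cellIncl_congr t (show (g * h)⁻¹ • y = h⁻¹ • g⁻¹ • y by simp [mul_smul])]
    simp [Prod.map_def, mul_assoc, Function.comp_def]

theorem cellDeg_cellShift (n : ℕ) (g : G) (y : CyclicCoset G)
    (b : Option (Fin n × CosetElt (g⁻¹ • y))) : cellDeg (cellShift n g y b) = cellDeg b := by
  cases b <;> rfl

theorem cellD_cellShift (k : Type) [Field k] [DecidableEq G] (n : ℕ) (g : G) (y : CyclicCoset G)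
    [Fintype (CosetElt y)] [Fintype (CosetElt (g⁻¹ • y))]
    (b c : Option (Fin n × CosetElt (g⁻¹ • y))) :
    cellD k n (cosetPerm y) (cellShift n g y b) (cellShift n g y c) =
      cellD k n (cosetPerm (g⁻¹ • y)) b c := by
  rcases b with _ | ⟨i, b⟩ <;> rcases c with _ | ⟨j, c⟩ <;>
    simp only [cellShift, cellD, Equiv.optionCongr_apply, Option.map_none, Option.map_some,
      Equiv.prodCongr_apply, Prod.map, Equiv.refl_apply]
  have h1 : cosetShift g y b = (cosetPerm y).symm (cosetShift g y c) ↔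
      b = (cosetPerm (g⁻¹ • y)).symm c := by
    simp only [Subtype.ext_iff, cosetPerm_symm_apply_coe, cosetShift_apply_coe, mul_assoc,
      mul_right_inj]
    rfl
  simp only [h1, EmbeddingLike.apply_eq_iff_eq]

theorem exists_res_of_trivial {k : Type} [Field k] [Fintype G]
    (hG : (-1 : k) ^ Fintype.card G = -1) {K : Type} [AddCommGroup K]
    [Module (MonoidAlgebra k G) K] (κ : k ≃+ K)
    (hκ : ∀ (g : G) (c x : k), κ (c * x) = single g c • κ x) (r : ℕ) :
    ∃ n, Res k G r n K := by
  classical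
  let n := 2 * (r + 1)
  have hn : Even n := even_two_mul _
  have hn' : 0 < n := by omega
  have := Fintype.ofFinite (CyclicCoset G)
  have (y : CyclicCoset G) : Nonempty (CosetElt y) :=
    ⟨⟨Quotient.out y.2, Quotient.out_eq y.2⟩⟩
  let _ := cellAction G n
  obtain ⟨e, he⟩ := exists_signSystem (Y := CyclicCoset G) k hG
  choose X hdeg hd haug using fun y : CyclicCoset G =>
    exists_cellComplex (k := k) (cosetPerm y) (exists_cosetPerm_pow y) hn hn'
  have ha (g : G) (t : ∀ y : CyclicCoset G, Option (Fin n × CosetElt y)) (y : CyclicCoset G) :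
      (g • t) y = cellShift n g y (t (g⁻¹ • y)) := rfl
  have hdeg' (g : G) (y : CyclicCoset G) (b) :
      (X y).deg (cellShift n g y b) = (X (g⁻¹ • y)).deg b := by
    rw [hdeg, hdeg, cellDeg_cellShift]
  have hd' (g : G) (y : CyclicCoset G) (b c) :
      (X y).d (cellShift n g y b) (cellShift n g y c) = (X (g⁻¹ • y)).d b c := by
    rw [hd, hd, cellD_cellShift]
  have haug' (g : G) (y : CyclicCoset G) (b) :
      (X y).aug (cellShift n g y b) = (X (g⁻¹ • y)).aug b := by
    rw [haug, haug, cellAug, cellDeg_cellShift]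
    rfl
  refine exists_res_of_graded (tensorDeg X) (tensorDeg_smul X _ ha hdeg') (tensorD e X)
    (tensorAug X) (tensorD_smul e X _ ha he hdeg' hd') (tensorAug_smul X _ ha haug')
    (tensorD_apply_eq_zero e X) (tensorAug_eq_zero X) (tensorD_tensorD e X)
    (tensorAug_tensorD e X) (fun f => exists_tensorD_eq e X) (tensorAug_surjective X) r ?_ κ hκ
  intro t ht g hgt
  let y : CyclicCoset G := ⟨g, (1 : G)⟩
  have hy : g⁻¹ • y = y := by
    refine Sigma.ext rfl (heq_of_eq ?_)
    change ((g⁻¹ * 1 : G) : G ⧸ Subgroup.zpowers g) = ((1 : G) : G ⧸ Subgroup.zpowers g)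
    rw [QuotientGroup.eq]
    simp
  have h1 : cellDeg (t y) < n := by
    rw [← hdeg]
    refine lt_of_le_of_lt ?_ (ht.trans (by omega : r < n))
    exact Finset.single_le_sum (f := fun y => (X y).deg (t y)) (fun _ _ => Nat.zero_le _)
      (Finset.mem_univ y)
  have h2 : cellIncl n y (t y) = Option.map (Prod.map id (g * ·)) (cellIncl n y (t y)) := by
    conv_lhs => rw [← hgt, ha, cellIncl_cellShift, cellIncl_congr t hy]
  match hty : t y with
  | none => simp [hty, cellDeg] at h1
  | some (i, x) =>
    rw [hty] at h2
    simpa [cellIncl] using h2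

end

end PermRes

namespace PermRes

open MonoidAlgebra

section

variable {k S : Type} [Field k] [Group S] {p : ℕ} [Fact p.Prime] [CharP k p]

theorem neg_one_pow_card [Fintype S] (hS : IsPGroup p S) :
    (-1 : k) ^ Fintype.card S = -1 := by
  obtain ⟨n, hn⟩ := IsPGroup.iff_card.1 hS
  rw [← Nat.card_eq_fintype_card, hn]
  rcases (Fact.out : p.Prime).eq_two_or_odd' with rfl | h
  · have : CharP k 2 := inferInstance
    rw [CharTwo.neg_eq, one_pow]
  · exact (h.pow).neg_one_pow

theorem exists_fixed_vector [Finite S] (hS : IsPGroup p S) (V : Type) [AddCommGroup V]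
    [Module (MonoidAlgebra k S) V] [Nontrivial V] :
    ∃ v : V, v ≠ 0 ∧ ∀ g : S, single g (1 : k) • v = v := by
  obtain ⟨w, hw⟩ := exists_ne (0 : V)
  have hp (x : V) : p • x = 0 := by
    have h : (p : MonoidAlgebra k S) = 0 := by
      rw [MonoidAlgebra.natCast_def, CharP.cast_eq_zero, MonoidAlgebra.single_zero]
    rw [← Nat.cast_smul_eq_nsmul (MonoidAlgebra k S), h, zero_smul]
  let A := AddSubgroup.closure (Set.range fun g : S => single g (1 : k) • w)
  have hwA : w ∈ A := AddSubgroup.subset_closure ⟨1, one_smul (MonoidAlgebra k S) w⟩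
  have : AddGroup.FG A := (AddGroup.fg_iff_addSubgroup_fg A).2
    ⟨(Set.finite_range _).toFinset, by rw [Set.Finite.coe_toFinset]⟩
  have : Finite A := AddCommGroup.finite_of_fg_isAddTorsion A fun x =>
    isOfFinAddOrder_iff_nsmul_eq_zero.2 ⟨p, (Fact.out : p.Prime).pos, Subtype.ext (hp x)⟩
  have hA (g : S) (x : V) (hx : x ∈ A) : single g (1 : k) • x ∈ A := by
    induction hx using AddSubgroup.closure_induction with
    | mem x hx =>
      obtain ⟨h, rfl⟩ := hx
      refine AddSubgroup.subset_closure ⟨g * h, ?_⟩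
      simp only [smul_smul, single_mul_single, mul_one]
    | zero => rw [smul_zero]; exact A.zero_mem
    | add x y _ _ hx hy => rw [smul_add]; exact A.add_mem hx hy
    | neg x _ hx => rw [smul_neg]; exact A.neg_mem hx
  let _ : MulAction S A :=
    { smul := fun g x => ⟨single g (1 : k) • x.1, hA g x.1 x.2⟩
      one_smul := fun x => Subtype.ext (one_smul _ _)
      mul_smul := fun g h x => Subtype.ext (by
        change single (g * h) (1 : k) • x.1 = single g (1 : k) • single h (1 : k) • x.1
        rw [smul_smul, single_mul_single, mul_one]) }
  have hdvd : p ∣ Nat.card A := by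
    have : addOrderOf (⟨w, hwA⟩ : A) = p :=
      addOrderOf_eq_prime (Subtype.ext (hp w)) fun h => hw (congrArg Subtype.val h)
    rw [← this]
    exact addOrderOf_dvd_natCard _
  obtain ⟨b, hb, hb0⟩ := hS.exists_fixed_point_of_prime_dvd_card_of_fixed_point A hdvd
    (a := 0) fun g => Subtype.ext (smul_zero _)
  exact ⟨b.1, fun h => hb0 (Subtype.ext h.symm), fun g => congrArg Subtype.val (hb g)⟩

theorem exists_res_span_singleton [Fintype S] (hS : IsPGroup p S) {V : Type} [AddCommGroup V]
    [Module (MonoidAlgebra k S) V] {v : V} (hv : v ≠ 0)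
    (hv' : ∀ g : S, single g (1 : k) • v = v) (r : ℕ) :
    ∃ n, Res k S r n (Submodule.span (MonoidAlgebra k S) {v}) := by
  have h1 (g : S) (c : k) : single g c • v = single (1 : S) c • v := by
    conv_rhs => rw [← hv' g, smul_smul, single_mul_single, one_mul, mul_one]
  let f : k →+ Submodule.span (MonoidAlgebra k S) {v} :=
    { toFun := fun c => ⟨single (1 : S) c • v,
        Submodule.smul_mem _ _ (Submodule.mem_span_singleton_self v)⟩
      map_zero' := Subtype.ext (by simp)
      map_add' := fun a b => Subtype.ext (by simp [single_add, add_smul]) }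
  have hf : Function.Bijective f := by
    constructor
    · rw [injective_iff_map_eq_zero]
      intro c hc
      by_contra h
      refine hv ?_
      have hc : single (1 : S) c • v = 0 := congrArg Subtype.val hc
      have := congrArg (single (1 : S) c⁻¹ • ·) hc
      simpa [smul_smul, single_mul_single, h, ← one_def] using this
    · rintro ⟨x, hx⟩
      obtain ⟨a, rfl⟩ := Submodule.mem_span_singleton.1 hx
      suffices ∃ c, single (1 : S) c • v = a • v from this.imp fun _ h => Subtype.ext h
      induction a using MonoidAlgebra.induction_linear with
      | zero => exact ⟨0, by simp⟩
      | add a b ha hb =>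
        obtain ⟨c, hc⟩ := ha (Submodule.mem_span_singleton.2 ⟨_, rfl⟩)
        obtain ⟨d, hd⟩ := hb (Submodule.mem_span_singleton.2 ⟨_, rfl⟩)
        exact ⟨c + d, by rw [single_add, add_smul, add_smul, hc, hd]⟩
      | single g c => exact ⟨c, (h1 g c).symm⟩
  refine exists_res_of_trivial (neg_one_pow_card hS) (AddEquiv.ofBijective f hf) ?_ r
  intro g c x
  refine Subtype.ext ?_
  change single (1 : S) (c * x) • v = single g c • single (1 : S) x • v
  rw [smul_smul, single_mul_single, mul_one, h1 g]

theorem exists_res_of_isPGroup [Fintype S] (hS : IsPGroup p S) (M : Type) [AddCommGroup M]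
    [Module (MonoidAlgebra k S) M] [Module.Finite (MonoidAlgebra k S) M] (r : ℕ) :
    ∃ n, Res k S r n M := by
  have : IsNoetherianRing (MonoidAlgebra k S) := isNoetherian_of_tower k inferInstance
  suffices H : ∀ (I : Submodule (MonoidAlgebra k S) M) (r : ℕ), ∃ n, Res k S r n (M ⧸ I) from
    (H ⊥ r).imp fun n h => h.congr (Submodule.quotEquivOfEqBot ⊥ rfl)
  intro I
  induction I using IsNoetherian.induction with
  | hgt I ih =>
  intro r
  rcases subsingleton_or_nontrivial (M ⧸ I) with h | h
  · exact ⟨0, h⟩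
  obtain ⟨v, hv, hv'⟩ := exists_fixed_vector (k := k) hS (M ⧸ I)
  let A := Submodule.span (MonoidAlgebra k S) {v}
  let J := A.comap I.mkQ
  have hIJ : I ≤ J := fun x hx => by
    have h0 : I.mkQ x = 0 := (Submodule.Quotient.mk_eq_zero I).2 hx
    exact Submodule.mem_comap.2 (h0 ▸ A.zero_mem)
  have hIJ' : I < J := by
    refine lt_of_le_of_ne hIJ fun h => ?_
    obtain ⟨x, rfl⟩ := I.mkQ_surjective v
    refine hv ((Submodule.Quotient.mk_eq_zero I).2 ?_)
    rw [h]
    exact Submodule.mem_span_singleton_self _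
  obtain ⟨a, ha⟩ := exists_res_span_singleton hS hv hv' r
  obtain ⟨c, hc⟩ := ih J hIJ' (max r a)
  refine ⟨max a c, Res.extension A.subtype (Submodule.factor hIJ) A.subtype_injective ?_
    (Submodule.factor_surjective hIJ) (le_max_left _ _) (le_max_right r a) (le_max_left _ _)
    (le_max_right _ _) ha hc⟩
  intro x
  obtain ⟨x, rfl⟩ := I.mkQ_surjective x
  have h : Submodule.factor hIJ (I.mkQ x) = 0 ↔ I.mkQ x ∈ A :=
    Submodule.Quotient.mk_eq_zero J
  rw [h]
  exact ⟨fun h => ⟨⟨_, h⟩, rfl⟩, fun ⟨y, hy⟩ => hy ▸ y.2⟩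

end

end PermRes

namespace PermRes

open MonoidAlgebra

section

variable {k G : Type} [Field k] [Group G] {S : Subgroup G}

/-- `V` is the coinduction of `W`: the elements of `V` are identified with the `S`-equivariant
functions from `G` to `W`. -/
structure Coinduction (k : Type) {G : Type} [Field k] [Group G] (S : Subgroup G) (W V : Type) [AddCommGroup W] [Module (MonoidAlgebra k S) W]
    [AddCommGroup V] [Module (MonoidAlgebra k G) V] where
  /-- The function attached to an element of `V`. -/
  ev : V →+ G → W
  injective : Function.Injective ev
  ev_smul : ∀ (x : G) (c : k) (v : V) (g : G),
    ev (single x c • v) g = single (1 : S) c • ev v (g * x)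
  ev_mul : ∀ (v : V) (s : S) (g : G), ev v (s * g) = single s (1 : k) • ev v g
  exists_ev : ∀ f : G → W, (∀ (s : S) (g : G), f (s * g) = single s (1 : k) • f g) → ∃ v, ev v = f

namespace Coinduction

section

variable {W V W' V' : Type} [AddCommGroup W] [Module (MonoidAlgebra k S) W]
    [AddCommGroup V] [Module (MonoidAlgebra k G) V] [AddCommGroup W']
    [Module (MonoidAlgebra k S) W'] [AddCommGroup V'] [Module (MonoidAlgebra k G) V']

theorem exists_map (C : Coinduction k S W V) (C' : Coinduction k S W' V')
    (π : W →ₗ[MonoidAlgebra k S] W') :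
    ∃ f : V →ₗ[MonoidAlgebra k G] V', ∀ v g, C'.ev (f v) g = π (C.ev v g) := by
  choose f hf using fun v : V => C'.exists_ev (fun g => π (C.ev v g)) fun s g => by
    rw [C.ev_mul, map_smul]
  refine ⟨linearMapOfSingle ⟨⟨f, ?_⟩, ?_⟩ ?_, fun v g => congrFun (hf v) g⟩
  · apply C'.injective
    rw [hf, map_zero, map_zero]
    ext g
    simp
  · intro v w
    apply C'.injective
    change C'.ev (f (v + w)) = C'.ev (f v + f w)
    rw [hf, map_add, map_add, hf, hf]
    ext g
    simp
  · intro g c v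
    apply C'.injective
    change C'.ev (f (single g c • v)) = C'.ev (single g c • f v)
    ext x
    rw [C'.ev_smul, hf, hf]
    simp only [C.ev_smul, map_smul]

theorem exists_section (S : Subgroup G) : ∃ (r : G → G) (σ : G → S),
    (∀ g, σ g * r g = g) ∧ (∀ (s : S) g, r (s * g) = r g) ∧
    ∀ (s : S) g, σ (s * g) = s * σ g := by
  let r : G → G := fun g => (Quotient.mk (QuotientGroup.rightRel S) g).out
  have h1 (g : G) : g * (r g)⁻¹ ∈ S :=
    QuotientGroup.rightRel_apply.1 (Quotient.mk_out (s := QuotientGroup.rightRel S) g)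
  have h2 (s : S) (g : G) : r (s * g) = r g := by
    have : Quotient.mk (QuotientGroup.rightRel S) (s * g) =
        Quotient.mk (QuotientGroup.rightRel S) g :=
      Quotient.sound (QuotientGroup.rightRel_apply.2 (by simp))
    simp only [r, this]
  refine ⟨r, fun g => ⟨_, h1 g⟩, fun g => by simp, h2, fun s g => Subtype.ext ?_⟩
  simp only [h2, Subgroup.coe_mul, mul_assoc]

theorem map_surjective (C : Coinduction k S W V) (C' : Coinduction k S W' V')
    {π : W →ₗ[MonoidAlgebra k S] W'} (hπ : Function.Surjective π)
    {f : V →ₗ[MonoidAlgebra k G] V'} (hf : ∀ v g, C'.ev (f v) g = π (C.ev v g)) :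
    Function.Surjective f := by
  intro v
  obtain ⟨r, σ, h1, h2, h3⟩ := exists_section S
  choose l hl using hπ
  obtain ⟨w, hw⟩ := C.exists_ev (fun g => single (σ g) (1 : k) • l (C'.ev v (r g))) fun s g => by
    rw [h2, h3, smul_smul, single_mul_single, mul_one]
  refine ⟨w, C'.injective ?_⟩
  ext g
  rw [hf, hw, map_smul, hl, ← C'.ev_mul, h1]

/-- The kernel of a coinduced map is the coinduction of the kernel. -/
def ker (C : Coinduction k S W V) (C' : Coinduction k S W' V')
    {π : W →ₗ[MonoidAlgebra k S] W'}
    {f : V →ₗ[MonoidAlgebra k G] V'} (hf : ∀ v g, C'.ev (f v) g = π (C.ev v g)) :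
    Coinduction k S (LinearMap.ker π) (LinearMap.ker f) where
  ev :=
    { toFun := fun v g => ⟨C.ev v.1 g, by
        rw [LinearMap.mem_ker, ← hf, v.2, map_zero, Pi.zero_apply]⟩
      map_zero' := by ext g; simp
      map_add' := fun v w => by ext g; simp }
  injective v w h := Subtype.ext <| C.injective <| by
    ext g
    exact congrArg Subtype.val (congrFun h g)
  ev_smul x c v g := Subtype.ext (C.ev_smul x c v.1 g)
  ev_mul v s g := Subtype.ext (C.ev_mul v.1 s g)
  exists_ev φ hφ := by
    obtain ⟨v, hv⟩ := C.exists_ev (fun g => (φ g).1) fun s g => congrArg Subtype.val (hφ s g)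
    refine ⟨⟨v, C'.injective ?_⟩, ?_⟩
    · ext g
      rw [hf, hv, map_zero]
      exact (φ g).2
    · ext g
      exact congrFun hv g

end

/-- The equivalence relation defining the `G`-set induced from an `S`-set. -/
abbrev inducedSetoid (S : Subgroup G) (X : Type) [MulAction S X] : Setoid (G × X) where
  r a b := ∃ s : S, (s * a.1, s • a.2) = b
  iseqv :=
    { refl := fun a => ⟨1, by simp⟩
      symm := by
        rintro a _ ⟨s, rfl⟩
        exact ⟨s⁻¹, by simp⟩
      trans := by
        rintro a _ _ ⟨s, rfl⟩ ⟨t, rfl⟩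
        exact ⟨t * s, by simp [mul_smul, mul_assoc]⟩ }

/-- The `G`-set induced from an `S`-set. -/
abbrev InducedSet (S : Subgroup G) (X : Type) [MulAction S X] : Type :=
  Quotient (inducedSetoid S X)

instance (S : Subgroup G) (X : Type) [MulAction S X] : MulAction G (InducedSet S X) where
  smul x := Quotient.map (fun a => (a.1 * x⁻¹, a.2)) <| by
    rintro a _ ⟨s, rfl⟩
    exact ⟨s, by simp [mul_assoc]⟩
  one_smul := by
    rintro ⟨a⟩
    exact congrArg (Quotient.mk _) (by simp)
  mul_smul := by
    rintro x y ⟨a⟩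
    exact congrArg (Quotient.mk _) (by simp [mul_assoc])

theorem exists_of_isPermutationModule [Finite G] {P : Type} [AddCommGroup P]
    [Module (MonoidAlgebra k S) P] (hP : IsPermutationModule k S P) :
    ∃ (Q : Type) (_ : AddCommGroup Q) (_ : Module (MonoidAlgebra k G) Q),
      IsPermutationModule k G Q ∧ Nonempty (Coinduction k S P Q) := by
  obtain ⟨X, _, _, e, he⟩ := exists_addEquiv_of_isPermutationModule hP
  let Z := InducedSet S X
  let mk : G → X → Z := fun g x => Quotient.mk _ (g, x)
  have hmk (a g : G) (x : X) : a • mk g x = mk (g * a⁻¹) x := rfl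
  have hmk' (s : S) (g : G) (x : X) : mk (s * g) x = mk g (s⁻¹ • x) :=
    Quotient.sound ⟨s⁻¹, by simp⟩
  refine ⟨(funRep k G Z).asModule, inferInstance, inferInstance, isPermutationModule_funRep, ⟨?_⟩⟩
  let q := (funRep k G Z).asModuleEquiv
  refine
    { ev :=
        { toFun := fun v g => e.symm fun x => q v (mk g x)
          map_zero' := ?_
          map_add' := ?_ }
      injective := ?_
      ev_smul := ?_
      ev_mul := ?_
      exists_ev := ?_ }
  · ext g
    apply e.injective
    ext x
    simp
  · intro v w
    ext g
    apply e.injective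
    ext x
    simp
  · intro v w h
    apply q.injective
    ext ⟨g, x⟩
    exact congrFun (e.symm.injective (congrFun h g)) x
  · intro a c v g
    apply e.injective
    ext x
    change e (e.symm fun x => q (single a c • v) (mk g x)) x =
      e (single 1 c • e.symm fun x => q v (mk (g * a) x)) x
    rw [he, e.apply_symm_apply, e.apply_symm_apply, asModuleEquiv_single_smul, hmk, inv_inv,
      inv_one, one_smul]
  · intro v s g
    apply e.injective
    ext x
    change e (e.symm fun x => q v (mk (s * g) x)) x =
      e (single s 1 • e.symm fun x => q v (mk g x)) x
    rw [he, e.apply_symm_apply, e.apply_symm_apply, hmk', one_mul]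
  · intro f hf
    refine ⟨q.symm (Quotient.lift (fun a : G × X => e (f a.1) a.2) ?_), ?_⟩
    · rintro ⟨g, x⟩ _ ⟨s, rfl⟩
      simp [hf, he]
    · ext g
      apply e.injective
      ext x
      change e (e.symm fun x => q (q.symm _) (mk g x)) x = _
      rw [e.apply_symm_apply, q.apply_symm_apply]
      rfl

theorem res [Finite G] {W V : Type} [AddCommGroup W] [Module (MonoidAlgebra k S) W]
    [AddCommGroup V] [Module (MonoidAlgebra k G) V] (C : Coinduction k S W V) {r n : ℕ}
    (h : Res k S r n W) : Res k G 0 n V := by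
  induction n generalizing r W V with
  | zero =>
    have : Subsingleton W := h
    exact C.injective.subsingleton
  | succ n ih =>
    obtain ⟨P, _, _, π, hP, -, hπ, hK⟩ := h
    obtain ⟨Q, _, _, hQ, ⟨D⟩⟩ := exists_of_isPermutationModule (G := G) hP
    obtain ⟨f, hf⟩ := D.exists_map C π
    exact ⟨Q, _, _, f, hQ, fun h => (lt_irrefl _ h).elim, D.map_surjective C hπ hf,
      ih (D.ker C hf) hK⟩

end Coinduction

end

end PermRes

namespace PermRes

open MonoidAlgebra

section

variable {k G : Type} [Field k] [Group G] (S : Subgroup G) (M : Type) [AddCommGroup M]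
  [Module k M] [Module (MonoidAlgebra k G) M] [IsScalarTower k (MonoidAlgebra k G) M]

/-- The diagonal action of `G` on the functions from `G ⧸ S` to `M`. -/
@[simps]
noncomputable def cosetRep : Representation k G (G ⧸ S → M) where
  toFun x :=
    { toFun := fun v q => single x (1 : k) • v (x⁻¹ • q)
      map_add' := fun v w => by ext q; simp
      map_smul' := fun c v => by
        ext q
        simp only [Pi.smul_apply, RingHom.id_apply]
        rw [← smul_one_smul (MonoidAlgebra k G) c (v _),
          ← smul_one_smul (MonoidAlgebra k G) c (single x (1 : k) • v _), smul_smul, smul_smul,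
          mul_smul_comm, smul_mul_assoc, mul_one, one_mul] }
  map_one' := by
    ext v q
    simp [← one_def]
  map_mul' x y := by
    ext v q
    change single (x * y) (1 : k) • v ((x * y)⁻¹ • q) =
      single x (1 : k) • single y (1 : k) • v (y⁻¹ • x⁻¹ • q)
    rw [smul_smul, single_mul_single, mul_one, mul_inv_rev, mul_smul y⁻¹]

variable {M}

theorem cosetRep_single_smul (x : G) (c : k) (v : (cosetRep (k := k) S M).asModule) (q : G ⧸ S) :
    (cosetRep S M).asModuleEquiv (single x c • v) q =
      single x c • (cosetRep S M).asModuleEquiv v (x⁻¹ • q) := by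
  rw [Representation.single_smul]
  change c • single x (1 : k) • (cosetRep S M).asModuleEquiv v (x⁻¹ • q) = _
  rw [← smul_assoc, smul_single, smul_eq_mul, mul_one]

variable [Module (MonoidAlgebra k S) M]

/-- The functions from `G ⧸ S` to `M` form the coinduction of the restriction of `M` to `S`. -/
noncomputable def cosetCoinduction (h : ∀ (s : S) (c : k) (m : M), single s c • m = single (s : G) c • m) :
    Coinduction k S M (cosetRep (k := k) S M).asModule where
  ev :=
    { toFun := fun v g => single g (1 : k) • (cosetRep (k := k) S M).asModuleEquiv v (g⁻¹ : G)
      map_zero' := by ext; simp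
      map_add' := fun v w => by ext; simp }
  injective v w hvw := by
    apply (cosetRep (k := k) S M).asModuleEquiv.injective
    ext ⟨g⟩
    have := congrArg (single g (1 : k) • ·) (congrFun hvw g⁻¹)
    simp only [AddMonoidHom.coe_mk, ZeroHom.coe_mk, smul_smul, single_mul_single, mul_inv_cancel,
      mul_one, ← one_def, one_smul, inv_inv] at this
    exact this
  ev_smul x c v g := by
    change single g (1 : k) • (cosetRep S M).asModuleEquiv (single x c • v) (g⁻¹ : G) =
      single (1 : S) c • single (g * x) (1 : k) •
        (cosetRep S M).asModuleEquiv v ((g * x)⁻¹ : G)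
    rw [cosetRep_single_smul, h, smul_smul, smul_smul, single_mul_single, single_mul_single,
      mul_inv_rev]
    simp
  ev_mul v s g := by
    simp [h, smul_smul, single_mul_single]
  exists_ev f hf := by
    refine ⟨(cosetRep S M).asModuleEquiv.symm (Quotient.lift (s := QuotientGroup.leftRel S)
      (fun g => single g (1 : k) • f g⁻¹) ?_), ?_⟩
    · intro a b hab
      have hab : a⁻¹ * b ∈ S := QuotientGroup.leftRel_apply.1 hab
      have := hf ⟨_, hab⟩ b⁻¹
      simp only [mul_assoc, mul_inv_cancel, mul_one, h] at this
      simp only [this, smul_smul, single_mul_single, mul_one, mul_inv_cancel_left]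
    · ext g
      change single g (1 : k) • single g⁻¹ (1 : k) • f g⁻¹⁻¹ = f g
      simp [smul_smul, single_mul_single, ← one_def]

end

theorem exists_complement {k G : Type} [Field k] [Group G] [Finite G] (S : Subgroup G)
    (hS : (S.index : k) ≠ 0) (M : Type) [AddCommGroup M] [Module (MonoidAlgebra k G) M]
    [Module.Finite (MonoidAlgebra k G) M] (r : ℕ)
    (hgood : ∀ (W : Type) [AddCommGroup W] [Module (MonoidAlgebra k S) W]
      [Module.Finite (MonoidAlgebra k S) W], ∃ n, Res k S r n W) :
    ∃ (N : Type) (_ : AddCommGroup N) (_ : Module (MonoidAlgebra k G) N),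
      Module.Finite (MonoidAlgebra k G) N ∧ ∃ n, Res k G 0 n (M × N) := by
  classical
  have := Fintype.ofFinite (G ⧸ S)
  let _ : Module k M := Module.compHom M (algebraMap k (MonoidAlgebra k G))
  have : IsScalarTower k (MonoidAlgebra k G) M := IsScalarTower.of_compHom k _ M
  let φ : MonoidAlgebra k S →ₐ[k] MonoidAlgebra k G := MonoidAlgebra.mapDomainAlgHom k k S.subtype
  let _ : Module (MonoidAlgebra k S) M := Module.compHom M φ.toRingHom
  have hφ (a : MonoidAlgebra k S) (m : M) : a • m = φ a • m := rfl
  have : IsScalarTower k (MonoidAlgebra k S) M :=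
    ⟨fun c a m => by rw [hφ, hφ, map_smul, smul_assoc]⟩
  have : Module.Finite k M := Module.Finite.trans (MonoidAlgebra k G) M
  have : Module.Finite (MonoidAlgebra k S) M := Module.Finite.of_restrictScalars_finite k _ M
  obtain ⟨n, hn⟩ := hgood M
  let q := (cosetRep (k := k) S M).asModuleEquiv
  let i : M →ₗ[MonoidAlgebra k G] (cosetRep (k := k) S M).asModule := linearMapOfSingle
    { toFun := fun m => q.symm fun _ => m
      map_zero' := by apply q.injective; ext; simp
      map_add' := fun m m' => by apply q.injective; ext; simp } <| by
    intro g c m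
    apply q.injective
    ext x
    change q (q.symm fun _ => single g c • m) x = q (single g c • q.symm fun _ => m) x
    rw [cosetRep_single_smul]
    simp [q]
  let ret : (cosetRep (k := k) S M).asModule →ₗ[MonoidAlgebra k G] M := linearMapOfSingle
    { toFun := fun v => ∑ x, q v x
      map_zero' := by simp
      map_add' := fun v w => by simp [Finset.sum_add_distrib] } <| by
    intro g c v
    change ∑ x, q (single g c • v) x = single g c • ∑ x, q v x
    rw [Finset.smul_sum]
    simp only [q, cosetRep_single_smul]
    exact Equiv.sum_comp (MulAction.toPerm g⁻¹) fun x => single g c • q v x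
  have hri (m : M) : ret (i m) = (S.index : k) • m := by
    change ∑ x : G ⧸ S, q (q.symm fun _ => m) x = _
    simp [Subgroup.index, Nat.cast_smul_eq_nsmul]
  refine ⟨LinearMap.ker ret, inferInstance, inferInstance, ?_, n, ?_⟩
  · have : IsNoetherianRing (MonoidAlgebra k G) := isNoetherian_of_tower k inferInstance
    have : Module.Finite (MonoidAlgebra k G) (cosetRep (k := k) S M).asModule :=
      Module.Finite.of_restrictScalars_finite k _ _
    infer_instance
  · have hres := (cosetCoinduction (k := k) S (M := M) fun s c m => by
      rw [hφ]; simp [φ]).res hn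
    refine hres.congr (LinearEquiv.ofBijective (i.coprod (LinearMap.ker ret).subtype) ⟨?_, ?_⟩).symm
    · rw [injective_iff_map_eq_zero]
      rintro ⟨m, x, hx⟩ h
      have h : i m + x = 0 := by simpa using h
      have h' := congrArg ret h
      rw [map_add, hri, hx, add_zero, map_zero, smul_eq_zero_iff_right hS] at h'
      subst h'
      rw [map_zero, zero_add] at h
      subst h
      rfl
    · intro v
      let m := (S.index : k)⁻¹ • ret v
      refine ⟨(m, ⟨v - i m, ?_⟩), by simp⟩
      rw [LinearMap.mem_ker, map_sub, hri, smul_inv_smul₀ hS, sub_self]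

theorem exists_complement_of_charP {p : ℕ} (hp : p.Prime) (k G : Type) [Field k] [CharP k p]
    [Group G] [Finite G] (M : Type) [AddCommGroup M] [Module (MonoidAlgebra k G) M]
    [Module.Finite (MonoidAlgebra k G) M] :
    ∃ (N : Type) (_ : AddCommGroup N) (_ : Module (MonoidAlgebra k G) N),
      Module.Finite (MonoidAlgebra k G) N ∧ HasFinitePermRes k G (M × N) := by
  have : Fact p.Prime := ⟨hp⟩
  obtain ⟨S⟩ : Nonempty (Sylow p G) := inferInstance
  have := Fintype.ofFinite S
  obtain ⟨N, _, _, hN, n, h⟩ := exists_complement (S : Subgroup G)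
    (fun h => S.not_dvd_index ((CharP.cast_eq_zero_iff k p _).1 h)) M 0
    fun W _ _ _ => exists_res_of_isPGroup S.isPGroup' W 0
  exact ⟨N, _, _, hN, h.hasFinitePermRes⟩

end PermRes

/-- **Theorem (Balmer–Benson).** Let `G` be a finite group and `k` a field of
characteristic `p > 0` dividing the order of `G`.  For every finite-dimensional
`kG`-module `M` there is a finite-dimensional `kG`-module `N` such that `M ⊕ N`
admits a finite resolution by permutation modules. -/
theorem exists_complement_with_finite_permutation_resolution
    (p : ℕ) (hp : p.Prime) (k : Type) [Field k] [CharP k p]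
    (G : Type) [Group G] [Fintype G] (hdvd : p ∣ Fintype.card G)
    (M : Type) [AddCommGroup M] [Module (MonoidAlgebra k G) M]
    [Module.Finite (MonoidAlgebra k G) M] :
    ∃ (N : Type) (_ : AddCommGroup N) (_ : Module (MonoidAlgebra k G) N),
      Module.Finite (MonoidAlgebra k G) N ∧
      HasFinitePermRes k G (M × N) := by
  exact PermRes.exists_complement_of_charP hp k G M
end

section
/- Let G be a finite p-group and k a field of characteristic p > 0. Let 0 → L → M → N → 0 be a short exact sequence of finite-dimensional kG-modules. If two out of the three modules L, M, N admit good permutation resolutions, then so does the third. -/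
open CategoryTheory

namespace IsPermutationModule

variable {k G : Type} [Field k] [Group G]
  {P Q : Type} [AddCommGroup P] [Module (MonoidAlgebra k G) P]
  [AddCommGroup Q] [Module (MonoidAlgebra k G) Q]

theorem of_equiv (e : P ≃ₗ[MonoidAlgebra k G] Q) (h : IsPermutationModule k G P) :
    IsPermutationModule k G Q := by
  obtain ⟨X, hX, hm, ⟨e'⟩⟩ := h
  exact ⟨X, hX, hm, ⟨e.symm.trans e'⟩⟩

theorem of_subsingleton [Subsingleton P] : IsPermutationModule k G P := by
  let m : MulAction G Empty :=
    { smul := fun _ x => x, one_smul := fun _ => rfl, mul_smul := fun _ _ _ => rfl }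
  have : Subsingleton (@Representation.ofMulAction k _ G _ Empty m).asModule :=
    (@Representation.ofMulAction k _ G _ Empty m).asModuleEquiv.toEquiv.trans
      (MonoidAlgebra.coeffLinearEquiv k).toEquiv |>.subsingleton
  exact ⟨Empty, inferInstance, m, ⟨LinearEquiv.ofBijective 0
    ⟨fun _ _ _ => Subsingleton.elim _ _, fun _ => ⟨0, Subsingleton.elim _ _⟩⟩⟩⟩

theorem prod (hP : IsPermutationModule k G P) (hQ : IsPermutationModule k G Q) :
    IsPermutationModule k G (P × Q) := by
  obtain ⟨X, hX, hm, ⟨e⟩⟩ := hP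
  obtain ⟨Y, hY, hn, ⟨e'⟩⟩ := hQ
  let ρ := Representation.ofMulAction k G X
  let σ := Representation.ofMulAction k G Y
  let τ := Representation.ofMulAction k G (X ⊕ Y)
  let c : τ.asModule ≃ₗ[k] ρ.asModule × σ.asModule :=
    τ.asModuleEquiv ≪≫ₗ MonoidAlgebra.coeffLinearEquiv k ≪≫ₗ
      Finsupp.sumFinsuppLEquivProdFinsupp k ≪≫ₗ
      ((MonoidAlgebra.coeffLinearEquiv k).symm ≪≫ₗ ρ.asModuleEquiv.symm).prodCongr
        ((MonoidAlgebra.coeffLinearEquiv k).symm ≪≫ₗ σ.asModuleEquiv.symm)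
  have hc : ∀ (g : G) (v : τ.asModule),
      c.toLinearMap (MonoidAlgebra.single g (1 : k) • v) =
        MonoidAlgebra.single g (1 : k) • c.toLinearMap v := by
    intro g v
    rw [Prod.ext_iff, Prod.smul_fst, Prod.smul_snd]
    simp only [Representation.single_smul, one_smul]
    constructor
    · exact MonoidAlgebra.ext (Finsupp.ext fun x => (Representation.coeff_ofMulAction ..).trans
        (Representation.coeff_ofMulAction g (ρ.asModuleEquiv (c v).1) x).symm)
    · exact MonoidAlgebra.ext (Finsupp.ext fun x => (Representation.coeff_ofMulAction ..).trans
        (Representation.coeff_ofMulAction g (σ.asModuleEquiv (c v).2) x).symm)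
  exact ⟨X ⊕ Y, inferInstance, inferInstance, ⟨(e.prodCongr e').trans
    (LinearEquiv.ofBijective (MonoidAlgebra.equivariantOfLinearOfComm c.toLinearMap hc)
      c.bijective).symm⟩⟩

end IsPermutationModule

theorem LinearMap.exists_shortExact_ker_prod {A L M N Q : Type} [Ring A]
    [AddCommGroup L] [Module A L] [AddCommGroup M] [Module A M] [AddCommGroup N] [Module A N]
    [AddCommGroup Q] [Module A Q] [Module.Projective A Q]
    (f : L →ₗ[A] M) (g : M →ₗ[A] N) (hf : Function.Injective f) (hg : Function.Surjective g)
    (hfg : Function.Exact f g) (q : Q →ₗ[A] N) (hq : Function.Surjective q) :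
    ∃ (f' : LinearMap.ker q →ₗ[A] L × Q) (g' : L × Q →ₗ[A] M),
      Function.Injective f' ∧ Function.Surjective g' ∧ Function.Exact f' g' := by
  obtain ⟨h, hh⟩ := Module.projective_lifting_property g q hg
  have hh' (x : Q) : g (h x) = q x := LinearMap.congr_fun hh x
  let j : LinearMap.ker q →ₗ[A] LinearMap.range f :=
    (h.comp (LinearMap.ker q).subtype).codRestrict _ fun x =>
      (hfg _).1 ((hh' x).trans x.2)
  let e := LinearEquiv.ofInjective f hf
  have he (x : LinearMap.ker q) : f (e.symm (j x)) = h x :=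
    congrArg Subtype.val <| e.apply_symm_apply (j x)
  refine ⟨(-(e.symm.toLinearMap.comp j)).prod (LinearMap.ker q).subtype, f.coprod h,
    fun x y hxy => Subtype.ext (congrArg Prod.snd hxy), fun m => ?_, ?_⟩
  · obtain ⟨x, hx⟩ := hq (g m)
    obtain ⟨l, hl⟩ := (hfg (m - h x)).1 (by rw [map_sub, hh', hx, sub_self])
    exact ⟨(l, x), by simp [hl]⟩
  · rintro ⟨l, x⟩
    constructor
    · intro hlx
      have hlx' : f l + h x = 0 := by simpa using hlx
      have hx : q x = 0 := by
        have := congrArg g hlx'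
        rwa [map_add, hfg.apply_apply_eq_zero, hh', zero_add, map_zero] at this
      refine ⟨⟨x, hx⟩, Prod.ext (hf ?_) rfl⟩
      have := he ⟨x, hx⟩
      refine (map_neg f _).trans ?_
      refine (congrArg Neg.neg this).trans ?_
      exact (eq_neg_of_add_eq_zero_left hlx').symm
    · rintro ⟨y, hy⟩
      rw [← hy]
      have := he y
      simp [this]

/-- `PermResolved k G n m M`: there is a permutation resolution of `M` of length at most `n`
whose terms in degrees `< m` are free. -/
def PermResolved (k G : Type) [Field k] [Group G] :
    ℕ → ℕ → ∀ (M : Type) [AddCommGroup M] [Module (MonoidAlgebra k G) M], Prop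
  | 0, m, M, _, _ => IsPermutationModule k G M ∧ (0 < m → Module.Free (MonoidAlgebra k G) M)
  | n + 1, m, M, _, _ => ∃ (P : ModuleCat.{0} (MonoidAlgebra k G))
      (q : P →ₗ[MonoidAlgebra k G] M), Function.Surjective q ∧ IsPermutationModule k G P ∧
      (0 < m → Module.Free (MonoidAlgebra k G) P) ∧ PermResolved k G n (m - 1) (LinearMap.ker q)

namespace PermResolved

variable {k G : Type} [Field k] [Group G]
  {L M N : Type} [AddCommGroup L] [Module (MonoidAlgebra k G) L]
  [AddCommGroup M] [Module (MonoidAlgebra k G) M]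
  [AddCommGroup N] [Module (MonoidAlgebra k G) N] {m n r s : ℕ}

theorem of_equiv (e : M ≃ₗ[MonoidAlgebra k G] N) (h : PermResolved k G n m M) :
    PermResolved k G n m N := by
  cases n with
  | zero =>
    refine ⟨h.1.of_equiv e, fun hm => ?_⟩
    have := h.2 hm
    exact Module.Free.of_equiv e
  | succ n =>
    obtain ⟨P, q, hq, hP, hF, hK⟩ := h
    refine ⟨P, e.toLinearMap.comp q, e.surjective.comp hq, hP, hF, ?_⟩
    rwa [LinearEquiv.ker_comp]

theorem mono (h : PermResolved k G n r M) (hmr : m ≤ r) : PermResolved k G n m M := by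
  induction n generalizing m r M with
  | zero => exact ⟨h.1, fun hm => h.2 (hm.trans_le hmr)⟩
  | succ n ih =>
    obtain ⟨P, q, hq, hP, hF, hK⟩ := h
    exact ⟨P, q, hq, hP, fun hm => hF (hm.trans_le hmr), ih hK (by omega)⟩

theorem of_subsingleton [Subsingleton M] : PermResolved k G 0 m M :=
  ⟨.of_subsingleton, fun _ => inferInstance⟩

theorem prod_free (h : PermResolved k G n m M) (hN : IsPermutationModule k G N)
    [Module.Free (MonoidAlgebra k G) N] : PermResolved k G n m (M × N) := by
  cases n with
  | zero =>
    refine ⟨h.1.prod hN, fun hm => ?_⟩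
    have := h.2 hm
    infer_instance
  | succ n =>
    obtain ⟨P, q, hq, hP, hF, hK⟩ := h
    refine ⟨ModuleCat.of _ (P × N), q.prodMap LinearMap.id, hq.prodMap Function.surjective_id,
      hP.prod hN, fun hm => ?_, ?_⟩
    · have := hF hm
      exact inferInstanceAs (Module.Free _ (P × N))
    · refine hK.of_equiv (LinearEquiv.ofBijective
        (((LinearMap.inl _ P N).comp (LinearMap.ker q).subtype).codRestrict _ fun x => ?_) ⟨?_, ?_⟩)
      · simp
      · intro x y hxy
        exact Subtype.ext (congrArg (fun z => z.1.1) hxy)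
      · rintro ⟨⟨x, y⟩, hxy⟩
        have hxy' : q x = 0 ∧ y = 0 := by simpa using hxy
        exact ⟨⟨x, hxy'.1⟩, Subtype.ext (Prod.ext rfl hxy'.2.symm)⟩

theorem exists_cover (h : PermResolved k G n m M) :
    ∃ (P : ModuleCat.{0} (MonoidAlgebra k G)) (q : P →ₗ[MonoidAlgebra k G] M) (n' : ℕ),
      Function.Surjective q ∧ IsPermutationModule k G P ∧
      (0 < m → Module.Free (MonoidAlgebra k G) P) ∧
      PermResolved k G n' (m - 1) (LinearMap.ker q) := by
  cases n with
  | zero =>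
    refine ⟨ModuleCat.of _ M, LinearMap.id, 0, Function.surjective_id, h.1, h.2, ?_⟩
    have : Subsingleton (LinearMap.ker (LinearMap.id : M →ₗ[MonoidAlgebra k G] M)) := by
      rw [LinearMap.ker_id]; infer_instance
    exact of_subsingleton
  | succ n =>
    obtain ⟨P, q, hq, hP, hF, hK⟩ := h
    exact ⟨P, q, n, hq, hP, hF, hK⟩

variable {f : L →ₗ[MonoidAlgebra k G] M} {g : M →ₗ[MonoidAlgebra k G] N}

theorem right (hf : Function.Injective f) (hg : Function.Surjective g)
    (hfg : Function.Exact f g) (hM : PermResolved k G n m M) (hL : PermResolved k G s r L)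
    (hnr : n ≤ r) (hmr : m ≤ r + 1) : ∃ n', PermResolved k G n' m N := by
  induction n generalizing m r s L M N with
  | zero =>
    refine ⟨s + 1, ModuleCat.of _ M, g, hg, hM.1, hM.2, ?_⟩
    rw [LinearMap.exact_iff.1 hfg]
    exact (hL.mono (by omega)).of_equiv (LinearEquiv.ofInjective f hf)
  | succ n ih =>
    obtain ⟨P, q, hq, hP, hF, hK⟩ := hM
    obtain ⟨P', q', s', hq', hP', hF', hK'⟩ := hL.exists_cover
    have := hF' (by omega)
    have : Module.Projective (MonoidAlgebra k G) P' := Module.Projective.of_free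
    let i : LinearMap.ker q →ₗ[MonoidAlgebra k G] LinearMap.ker (g.comp q) :=
      Submodule.inclusion (LinearMap.ker_le_ker_comp q g)
    let e := LinearEquiv.ofInjective f hf
    let t : LinearMap.ker (g.comp q) →ₗ[MonoidAlgebra k G] L :=
      e.symm.toLinearMap.comp ((q.comp (LinearMap.ker (g.comp q)).subtype).codRestrict
        (LinearMap.range f) fun x => (hfg _).1 x.2)
    have ht (x) : f (t x) = q x := congrArg Subtype.val <| e.apply_symm_apply _
    have hts : Function.Surjective t := fun l => by
      obtain ⟨x, hx⟩ := hq (f l)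
      refine ⟨⟨x, ?_⟩, hf ((ht _).trans hx)⟩
      rw [LinearMap.mem_ker, LinearMap.comp_apply, hx, hfg.apply_apply_eq_zero]
    have hit : Function.Exact i t := fun x => by
      rw [← map_eq_zero_iff f hf, ht]
      exact ⟨fun hx => ⟨⟨x, hx⟩, rfl⟩, fun ⟨y, hy⟩ => hy ▸ y.2⟩
    obtain ⟨f', g', hf', hg', hfg'⟩ := LinearMap.exists_shortExact_ker_prod i t
      (Submodule.inclusion_injective _) hts hit q' hq'
    obtain ⟨n', hn'⟩ := ih hf' hg' hfg' (hK.prod_free hP') hK' (by omega) (by omega)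
    exact ⟨n' + 1, P, g.comp q, hg.comp hq, hP, hF, hn'⟩

theorem middle (hf : Function.Injective f) (hg : Function.Surjective g)
    (hfg : Function.Exact f g) (hL : PermResolved k G n m L) (hN : PermResolved k G s r N)
    (hnr : n < r) (hmr : m ≤ r) : ∃ n', PermResolved k G n' m M := by
  obtain ⟨Q, q, s', hq, hQ, hF, hK⟩ := hN.exists_cover
  have := hF (by omega)
  have : Module.Projective (MonoidAlgebra k G) Q := Module.Projective.of_free
  obtain ⟨f', g', hf', hg', hfg'⟩ := LinearMap.exists_shortExact_ker_prod f g hf hg hfg q hq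
  exact right hf' hg' hfg' (hL.prod_free hQ) hK (by omega) (by omega)

theorem left (hf : Function.Injective f) (hg : Function.Surjective g)
    (hfg : Function.Exact f g) (hM : ∀ m, ∃ n, PermResolved k G n m M)
    (hN : PermResolved k G s (m + 1) N) : ∃ n', PermResolved k G n' m L := by
  obtain ⟨Q, q, s', hq, hQ, hF, hK⟩ := hN.exists_cover
  have := hF (by omega)
  have : Module.Projective (MonoidAlgebra k G) Q := Module.Projective.of_free
  obtain ⟨f', g', hf', hg', hfg'⟩ := LinearMap.exists_shortExact_ker_prod f g hf hg hfg q hq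
  obtain ⟨t, ht⟩ := hM (max (s' + 1) m)
  obtain ⟨u, hu⟩ := middle hf' hg' hfg' hK ht (by omega) (by omega)
  exact right (f := LinearMap.inr _ L Q) (g := LinearMap.fst _ L Q) LinearMap.inr_injective
    LinearMap.fst_surjective .inr_fst hu
    (show PermResolved k G 0 (max u m) Q from ⟨hQ, fun _ => hF (by omega)⟩) (by omega) (by omega)

theorem of_resolution (P : ℕ → ModuleCat.{0} (MonoidAlgebra k G)) (d : ∀ i, P (i + 1) ⟶ P i)
    (ε : P 0 →ₗ[MonoidAlgebra k G] M) (hP : ∀ i, IsPermutationModule k G (P i))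
    (hF : ∀ i < m, Module.Free (MonoidAlgebra k G) (P i)) (hn : ∀ i, n < i → Subsingleton (P i))
    (hε : Function.Surjective ε) (hd : Function.Exact (d 0) ε)
    (hdd : ∀ i, Function.Exact (d (i + 1)) (d i)) : PermResolved k G n m M := by
  induction n generalizing m M P with
  | zero =>
    have := hn 1 (by omega)
    have hinj : Function.Injective ε := by
      rw [injective_iff_map_eq_zero]
      intro x hx
      obtain ⟨y, rfl⟩ := (hd x).1 hx
      rw [Subsingleton.elim y 0, map_zero]
    let e := LinearEquiv.ofBijective ε ⟨hinj, hε⟩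
    refine ⟨(hP 0).of_equiv e, fun hm => ?_⟩
    have := hF 0 hm
    exact Module.Free.of_equiv e
  | succ n ih =>
    refine ⟨P 0, ε, hε, hP 0, hF 0, ih (fun i => P (i + 1)) (fun i => d (i + 1))
      ((d 0).hom.codRestrict (LinearMap.ker ε) fun x => hd.apply_apply_eq_zero x)
      (fun i => hP _) (fun i hi => hF _ (by omega)) (fun i hi => hn _ (by omega)) ?_ ?_
      (fun i => hdd _)⟩
    · rintro ⟨x, hx⟩
      obtain ⟨y, hy⟩ := (hd x).1 hx
      exact ⟨y, Subtype.ext hy⟩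
    · intro x
      rw [← hdd 0 x, Subtype.ext_iff]
      rfl

theorem exists_resolution (h : PermResolved k G n m M) :
    ∃ (P : ℕ → ModuleCat.{0} (MonoidAlgebra k G)) (d : ∀ i, P (i + 1) ⟶ P i)
      (ε : P 0 →ₗ[MonoidAlgebra k G] M), (∀ i, IsPermutationModule k G (P i)) ∧
      (∀ i < m, Module.Free (MonoidAlgebra k G) (P i)) ∧ (∀ i, n < i → Subsingleton (P i)) ∧
      Function.Surjective ε ∧ Function.Exact (d 0) ε ∧
      ∀ i, Function.Exact (d (i + 1)) (d i) := by
  induction n generalizing m M with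
  | zero =>
    refine ⟨fun i => Nat.casesOn i (ModuleCat.of _ M) fun _ => ModuleCat.of _ PUnit,
      fun i => 0, LinearMap.id, ?_, ?_, ?_, Function.surjective_id, ?_, ?_⟩
    · rintro (_ | i)
      · exact h.1
      · exact .of_subsingleton (P := PUnit)
    · rintro (_ | i) hi
      · exact h.2 hi
      · exact inferInstanceAs (Module.Free _ PUnit)
    · rintro (_ | i) hi
      · omega
      · exact inferInstanceAs (Subsingleton PUnit)
    · intro x
      exact ⟨fun hx => ⟨0, hx.symm⟩, fun ⟨y, hy⟩ => hy.symm⟩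
    · intro i x
      exact ⟨fun _ => ⟨0, Subsingleton.elim (α := PUnit) _ _⟩, fun _ => rfl⟩
  | succ n ih =>
    obtain ⟨P₀, q, hq, hP₀, hF₀, hK⟩ := h
    obtain ⟨P, d, ε, hP, hF, hn, hε, hd, hdd⟩ := ih hK
    let P' : ℕ → ModuleCat.{0} (MonoidAlgebra k G) := fun i => Nat.casesOn i P₀ P
    let d' : ∀ i, P' (i + 1) ⟶ P' i := fun i =>
      Nat.casesOn (motive := fun i => P' (i + 1) ⟶ P' i) i
        (ModuleCat.ofHom ((LinearMap.ker q).subtype.comp ε)) d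
    refine ⟨P', d', q, ?_, ?_, ?_, hq, ?_, ?_⟩
    · rintro (_ | i)
      exacts [hP₀, hP i]
    · rintro (_ | i) hi
      exacts [hF₀ hi, hF i (by omega)]
    · rintro (_ | i) hi
      exacts [absurd hi (by omega), hn i (by omega)]
    · intro x
      constructor
      · intro hx
        obtain ⟨y, hy⟩ := hε ⟨x, hx⟩
        exact ⟨y, congrArg Subtype.val hy⟩
      · rintro ⟨y, rfl⟩
        exact (ε y).2
    · rintro (_ | i)
      · intro x
        refine Iff.trans ?_ (hd x)
        exact (LinearMap.ker q).coe_eq_zero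
      · exact hdd i

end PermResolved

theorem hasPermResFreeUpTo_iff {k G : Type} [Field k] [Group G] {m : ℕ}
    {M : Type} [AddCommGroup M] [Module (MonoidAlgebra k G) M] :
    HasPermResFreeUpTo k G m M ↔ ∃ n, PermResolved k G n (m + 1) M := by
  constructor
  · rintro ⟨n, P, d, ε, hP, hF, hn, hε, hd, hdd⟩
    exact ⟨n, .of_resolution P d ε.hom hP (fun i hi => hF i (by omega)) hn hε hd hdd⟩
  · rintro ⟨n, h⟩
    obtain ⟨P, d, ε, hP, hF, hn, hε, hd, hdd⟩ := h.exists_resolution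
    exact ⟨n, P, d, ModuleCat.ofHom ε, hP, fun i hi => hF i (by omega), hn, hε, hd, hdd⟩

theorem hasGoodPermRes_iff {k G : Type} [Field k] [Group G]
    {M : Type} [AddCommGroup M] [Module (MonoidAlgebra k G) M] :
    HasGoodPermRes k G M ↔ ∀ m, ∃ n, PermResolved k G n m M := by
  simp only [HasGoodPermRes, hasPermResFreeUpTo_iff]
  refine ⟨fun h m => ?_, fun h m => h _⟩
  obtain ⟨n, hn⟩ := h m
  exact ⟨n, hn.mono (by omega)⟩

/-- **Two-out-of-three.** Let `G` be a finite `p`-group and `k` a field of characteristic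
`p > 0`.  Given a short exact sequence `0 → L → M → N → 0` of finite-dimensional
`kG`-modules, if two out of `L`, `M`, `N` admit good permutation resolutions then
so does the third. -/
theorem two_out_of_three_good_permutation_resolutions
    (p : ℕ) (hp : p.Prime) (k : Type) [Field k] [CharP k p]
    (G : Type) [Group G] [Finite G] (hG : IsPGroup p G)
    (L M N : Type)
    [AddCommGroup L] [Module (MonoidAlgebra k G) L] [Module.Finite (MonoidAlgebra k G) L]
    [AddCommGroup M] [Module (MonoidAlgebra k G) M] [Module.Finite (MonoidAlgebra k G) M]
    [AddCommGroup N] [Module (MonoidAlgebra k G) N] [Module.Finite (MonoidAlgebra k G) N]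
    (f : L →ₗ[MonoidAlgebra k G] M) (g : M →ₗ[MonoidAlgebra k G] N)
    (hf : Function.Injective f) (hg : Function.Surjective g)
    (hfg : Function.Exact f g) :
    (HasGoodPermRes k G L → HasGoodPermRes k G M → HasGoodPermRes k G N) ∧
    (HasGoodPermRes k G L → HasGoodPermRes k G N → HasGoodPermRes k G M) ∧
    (HasGoodPermRes k G M → HasGoodPermRes k G N → HasGoodPermRes k G L) := by
  simp only [hasGoodPermRes_iff]
  refine ⟨fun hL hM m => ?_, fun hL hN m => ?_, fun hM hN m => ?_⟩
  · obtain ⟨n, hn⟩ := hM m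
    obtain ⟨s, hs⟩ := hL (max n m)
    exact hn.right hf hg hfg hs (by omega) (by omega)
  · obtain ⟨n, hn⟩ := hL m
    obtain ⟨s, hs⟩ := hN (max (n + 1) m)
    exact hn.middle hf hg hfg hs (by omega) (by omega)
  · obtain ⟨s, hs⟩ := hN (m + 1)
    exact hs.left hf hg hfg hM
end
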